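/- arXiv:1812.09186 — 10 statements merged into one kernel-verified Lean document; each statement's English description precedes it below -/
import Mathlib

section
/- Let R be a commutative ring, let M and N be finite free R-modules (i.e., Module.Finite and Module.Free over R), and let φ : M →ₗ[R] N be an R-linear map. Then the dual map φ.dualMap : Dual R N → Dual R M is surjective if and only if for every maximal ideal m of R, the induced (R ⧸ m)-linear map between fibers M ⧸ (m • M) → N ⧸ (m • N) is injective. -/
/-- The fiber of a module `M` at a maximal ideal `m` is `M ⧸ m • M`; a linear map
`φ : M →ₗ[R] N` induces a map between fibers. -/
noncomputable def fiberMap {R : Type*} [CommRing R] {M N : Type*} [AddCommGroup M] [Module R M]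
    [AddCommGroup N] [Module R N] (φ : M →ₗ[R] N) (m : Ideal R) :
    (M ⧸ (m • ⊤ : Submodule R M)) →ₗ[R] (N ⧸ (m • ⊤ : Submodule R N)) :=
  Submodule.mapQ (m • ⊤) (m • ⊤) φ
    (by
      rw [← Submodule.map_le_iff_le_comap, Submodule.map_smul'']
      exact smul_mono_right _ le_top)

theorem fiberMap_comp {R : Type*} [CommRing R] {M N P : Type*} [AddCommGroup M] [Module R M]
    [AddCommGroup N] [Module R N] [AddCommGroup P] [Module R P]
    (ψ : N →ₗ[R] P) (φ : M →ₗ[R] N) (m : Ideal R) :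
    fiberMap (ψ ∘ₗ φ) m = fiberMap ψ m ∘ₗ fiberMap φ m :=
  Submodule.linearMap_qext _ rfl

theorem fiberMap_id {R : Type*} [CommRing R] {M : Type*} [AddCommGroup M] [Module R M]
    (m : Ideal R) : fiberMap (LinearMap.id : M →ₗ[R] M) m = LinearMap.id :=
  Submodule.linearMap_qext _ rfl

theorem LinearMap.exists_leftInverse_of_dualMap_surjective {R : Type*} [CommRing R] {M N : Type*}
    [AddCommGroup M] [Module R M] [Module.Finite R M] [Module.Free R M]
    [AddCommGroup N] [Module R N] {φ : M →ₗ[R] N} (h : Function.Surjective φ.dualMap) :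
    ∃ ψ : N →ₗ[R] M, ψ ∘ₗ φ = LinearMap.id := by
  let b := Module.Free.chooseBasis R M
  choose g hg using fun i => h (b.coord i)
  refine ⟨∑ i, (g i).smulRight (b i), LinearMap.ext fun x => ?_⟩
  have hx (i) : g i (φ x) = b.repr x i := LinearMap.congr_fun (hg i) x
  simp [hx, b.sum_repr]

/-- A submodule of a finite module that is everything modulo every maximal ideal is everything. -/
theorem Submodule.eq_top_of_forall_sup_smul_top_eq_top {R : Type*} [CommRing R] {P : Type*}
    [AddCommGroup P] [Module R P] [Module.Finite R P] (Q : Submodule R P)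
    (h : ∀ m : Ideal R, m.IsMaximal → Q ⊔ m • ⊤ = ⊤) : Q = ⊤ := by
  by_contra hQ
  have hne : Module.annihilator R (P ⧸ Q) ≠ ⊤ := by
    rw [Ne, Module.annihilator_eq_top_iff, Submodule.Quotient.subsingleton_iff]
    exact hQ
  obtain ⟨m, hm, hle⟩ := Ideal.exists_le_maximal _ hne
  have htop : (⊤ : Submodule R (P ⧸ Q)) ≤ m • ⊤ := by
    have := congrArg (Submodule.map Q.mkQ) (h m hm)
    rw [Submodule.map_sup, Submodule.map_smul'', Submodule.map_top, Submodule.range_mkQ,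
      Submodule.mkQ_map_self, bot_sup_eq] at this
    exact this.ge
  obtain ⟨r, hr, hr0⟩ := Submodule.exists_sub_one_mem_and_smul_eq_zero_of_fg_of_le_smul m ⊤
    Module.Finite.fg_top htop
  have hrm : r ∈ m := hle (Module.mem_annihilator.2 fun x => hr0 x trivial)
  exact hm.ne_top ((Ideal.eq_top_iff_one _).2 (by simpa using m.sub_mem hrm hr))

theorem Module.Dual.mem_smul_top_of_forall_mem {R : Type*} [CommRing R] {M : Type*}
    [AddCommGroup M] [Module R M] [Module.Finite R M] [Module.Free R M] {I : Ideal R}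
    {f : Module.Dual R M} (hf : ∀ x, f x ∈ I) : f ∈ I • (⊤ : Submodule R (Module.Dual R M)) := by
  let b := Module.Free.chooseBasis R M
  rw [← b.sum_dual_apply_smul_coord f]
  exact Submodule.sum_mem _ fun i _ => Submodule.smul_mem_smul (hf _) trivial

/-- Modulo a maximal ideal at which the fiber map of `φ` is injective, every functional on `M`
extends along `φ`. -/
theorem exists_comp_sub_mem_of_fiberMap_injective {R : Type*} [CommRing R] {M N : Type*}
    [AddCommGroup M] [Module R M] [AddCommGroup N] [Module R N] [Module.Projective R N]
    {φ : M →ₗ[R] N} {m : Ideal R} [m.IsMaximal] (h : Function.Injective (fiberMap φ m))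
    (f : Module.Dual R M) : ∃ g : Module.Dual R N, ∀ x, f x - g (φ x) ∈ m := by
  let := Ideal.Quotient.field m
  have hsurj : Function.Surjective (algebraMap R (R ⧸ m)) := Ideal.Quotient.mk_surjective
  obtain ⟨ψ, hψ⟩ := ((fiberMap φ m).extendScalarsOfSurjective hsurj).exists_leftInverse_of_injective
    (LinearMap.ker_eq_bot.2 h)
  let fbar : (M ⧸ (m • ⊤ : Submodule R M)) →ₗ[R] R ⧸ m :=
    Submodule.liftQ _ (m.mkQ ∘ₗ f) <| Submodule.smul_le.2 fun r hr x _ => by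
      refine (Submodule.Quotient.mk_eq_zero m).2 ?_
      rw [map_smul]
      exact m.mul_mem_right (f x) hr
  obtain ⟨g, hg⟩ := Module.projective_lifting_property m.mkQ
    (fbar ∘ₗ ψ.restrictScalars R ∘ₗ Submodule.mkQ _) (Submodule.mkQ_surjective _)
  refine ⟨g, fun x => (Submodule.Quotient.eq m).1 ?_⟩
  have hx : ψ (Submodule.Quotient.mk (φ x)) = Submodule.Quotient.mk x :=
    LinearMap.congr_fun hψ (Submodule.Quotient.mk x)
  have hgx : Submodule.Quotient.mk (g (φ x)) = fbar (ψ (Submodule.Quotient.mk (φ x))) :=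
    LinearMap.congr_fun hg (φ x)
  rw [hgx, hx]
  rfl

/-- For a map `φ : M →ₗ[R] N` of finite free modules, the dual map is surjective if and
only if the induced map on fibers at every maximal ideal is injective (i.e., `φ` is a
fiberwise monomorphism). -/
theorem dualMap_surjective_iff_fiberwise_injective {R : Type*} [CommRing R] {M N : Type*}
    [AddCommGroup M] [Module R M] [Module.Finite R M] [Module.Free R M]
    [AddCommGroup N] [Module R N] [Module.Finite R N] [Module.Free R N]
    (φ : M →ₗ[R] N) :
    Function.Surjective φ.dualMap ↔
      ∀ m : Ideal R, m.IsMaximal → Function.Injective (fiberMap φ m) := by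
  refine ⟨fun h m _ => ?_, fun h => LinearMap.range_eq_top.1 <|
    Submodule.eq_top_of_forall_sup_smul_top_eq_top _ fun m hm => eq_top_iff.2 fun f _ => ?_⟩
  · obtain ⟨ψ, hψ⟩ := LinearMap.exists_leftInverse_of_dualMap_surjective h
    refine Function.LeftInverse.injective (g := fiberMap ψ m) fun x => ?_
    rw [← LinearMap.comp_apply, ← fiberMap_comp, hψ, fiberMap_id, LinearMap.id_apply]
  · obtain ⟨g, hg⟩ := exists_comp_sub_mem_of_fiberMap_injective (h m hm) f
    rw [← add_sub_cancel (φ.dualMap g) f]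
    exact Submodule.add_mem_sup (LinearMap.mem_range_self _ g)
      (Module.Dual.mem_smul_top_of_forall_mem hg)
end

section
/- Let R be a commutative ring, let M and N be finitely generated projective R-modules, and let φ : M →ₗ[R] N be a surjective R-linear map. Then the kernel LinearMap.ker φ is a finitely generated projective R-module, and for every maximal ideal m of R, the induced (R ⧸ m)-linear map between fibers (ker φ) ⧸ (m • ker φ) → M ⧸ (m • M) is injective. -/
theorem fiberMap_injective_of_leftInverse {R : Type*} [CommRing R] {M N : Type*}
    [AddCommGroup M] [Module R M] [AddCommGroup N] [Module R N]
    {f : M →ₗ[R] N} {g : N →ₗ[R] M} (h : Function.LeftInverse g f) (m : Ideal R) :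
    Function.Injective (fiberMap f m) := by
  refine Function.LeftInverse.injective (g := fiberMap g m) fun x ↦ ?_
  obtain ⟨x, rfl⟩ := Submodule.Quotient.mk_surjective _ x
  simp [fiberMap, h x]

/-- The kernel of a surjection onto a projective module is a retract of the source. -/
theorem exists_leftInverse_subtype_ker_of_surjective {R : Type*} [CommRing R] {M N : Type*}
    [AddCommGroup M] [Module R M] [AddCommGroup N] [Module R N] [Module.Projective R N]
    (φ : M →ₗ[R] N) (hφ : Function.Surjective φ) :
    ∃ p : M →ₗ[R] LinearMap.ker φ, Function.LeftInverse p (LinearMap.ker φ).subtype := by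
  obtain ⟨s, hs⟩ := Module.projective_lifting_property φ LinearMap.id hφ
  refine ⟨(LinearMap.id - s ∘ₗ φ).codRestrict (LinearMap.ker φ) fun x ↦ ?_, fun x ↦ ?_⟩
  · ext
    simp
  · simpa [sub_eq_zero] using (LinearMap.congr_fun hs (φ x)).symm

/-- The kernel of a surjective map of finitely generated projective modules is finitely
generated projective, and its inclusion is injective on fibers at every maximal ideal. -/
theorem ker_of_surjective_finite_projective {R : Type*} [CommRing R] {M N : Type*}
    [AddCommGroup M] [Module R M] [Module.Finite R M] [Module.Projective R M]
    [AddCommGroup N] [Module R N] [Module.Finite R N] [Module.Projective R N]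
    (φ : M →ₗ[R] N) (hφ : Function.Surjective φ) :
    Module.Finite R (LinearMap.ker φ) ∧ Module.Projective R (LinearMap.ker φ) ∧
      ∀ m : Ideal R, m.IsMaximal →
        Function.Injective (fiberMap ((LinearMap.ker φ).subtype) m) := by
  obtain ⟨p, hp⟩ := exists_leftInverse_subtype_ker_of_surjective φ hφ
  exact ⟨Module.Finite.of_surjective p hp.surjective,
    Module.Projective.of_split (LinearMap.ker φ).subtype p (LinearMap.ext hp),
    fun m _ ↦ fiberMap_injective_of_leftInverse hp m⟩
end

section
/- Let R be a commutative ring, let f ∈ R be a non-zerodivisor, let M be a finite free R-module, let k be a natural number, and regard N := (Fin k → R ⧸ Ideal.span {f}) as an R-module. If φ : M →ₗ[R] N is a surjective R-linear map, then the kernel LinearMap.ker φ is a finitely generated projective R-module. -/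
/-- One half of Schanuel's lemma: if `M` and `P` are projective, then the kernel of `φ : M → N` is
a direct summand of `M × ker π` for surjections `φ : M → N` and `π : P → N`. -/
theorem LinearMap.exists_comp_eq_id_ker_of_surjective {R M P N : Type*} [Ring R]
    [AddCommGroup M] [Module R M] [AddCommGroup P] [Module R P] [AddCommGroup N] [Module R N]
    [Module.Projective R M] [Module.Projective R P] {φ : M →ₗ[R] N} {π : P →ₗ[R] N}
    (hφ : Function.Surjective φ) (hπ : Function.Surjective π) :
    ∃ (i : LinearMap.ker φ →ₗ[R] M × LinearMap.ker π)
      (r : M × LinearMap.ker π →ₗ[R] LinearMap.ker φ), r ∘ₗ i = LinearMap.id := by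
  obtain ⟨α, hα⟩ := Module.projective_lifting_property π φ hπ
  obtain ⟨β, hβ⟩ := Module.projective_lifting_property φ π hφ
  have hα' (x : M) : π (α x) = φ x := LinearMap.congr_fun hα x
  have hβ' (x : P) : φ (β x) = π x := LinearMap.congr_fun hβ x
  let toKer : LinearMap.ker φ →ₗ[R] LinearMap.ker π :=
    LinearMap.codRestrict _ (-(α ∘ₗ (LinearMap.ker φ).subtype)) fun x => by
      simp [hα']
  let r : M × LinearMap.ker π →ₗ[R] LinearMap.ker φ :=
    LinearMap.codRestrict _
      (LinearMap.fst R M _ - β ∘ₗ LinearMap.coprod α (LinearMap.ker π).subtype) fun x => by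
        simp [hα', hβ']
  refine ⟨(LinearMap.ker φ).subtype.prod toKer, r, ?_⟩
  ext x
  have hx : (toKer x : P) = -α x := rfl
  simp [r, hx]

/-- The kernel of the coordinatewise quotient map `Rᵏ → (R ⧸ (f))ᵏ` is the image of
multiplication by `f`. -/
theorem LinearMap.ker_compLeft_mkQ_span_singleton {R ι : Type*} [CommRing R] (f : R) :
    LinearMap.ker ((Ideal.span {f}).mkQ.compLeft ι) =
      LinearMap.range (LinearMap.lsmul R (ι → R) f) := by
  ext x
  simp only [LinearMap.mem_ker, LinearMap.mem_range, funext_iff, LinearMap.compLeft_apply,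
    Function.comp_apply, Pi.zero_apply, Submodule.mkQ_apply, Submodule.Quotient.mk_eq_zero,
    Ideal.mem_span_singleton, LinearMap.lsmul_apply, Pi.smul_apply, smul_eq_mul]
  simp only [Dvd.dvd, eq_comm, Classical.skolem]

/-- If `f` is a non-zerodivisor of `R` (so that `Spec (R ⧸ (f))` is an effective Cartier
divisor in `Spec R`), `M` is a finite free `R`-module and
`φ : M → (Fin k → R ⧸ (f))` is a surjective `R`-linear map onto a free module over
`R ⧸ (f)`, then the kernel of `φ` is a finitely generated projective `R`-module. -/
theorem ker_of_surjective_onto_cartier_divisor {R : Type*} [CommRing R]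
    (f : R) (hf : f ∈ nonZeroDivisors R)
    {M : Type*} [AddCommGroup M] [Module R M] [Module.Finite R M] [Module.Free R M]
    (k : ℕ) (φ : M →ₗ[R] (Fin k → R ⧸ Ideal.span {f}))
    (hφ : Function.Surjective φ) :
    Module.Finite R (LinearMap.ker φ) ∧ Module.Projective R (LinearMap.ker φ) := by
  let π : (Fin k → R) →ₗ[R] (Fin k → R ⧸ Ideal.span {f}) :=
    (Ideal.span {f}).mkQ.compLeft (Fin k)
  have hπ : Function.Surjective π := (Submodule.mkQ_surjective _).comp_left
  have hinj : Function.Injective (LinearMap.lsmul R (Fin k → R) f) := fun x y hxy =>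
    funext fun i => (mul_cancel_left_mem_nonZeroDivisors hf).mp (congrFun hxy i)
  let e : (Fin k → R) ≃ₗ[R] LinearMap.ker π :=
    (LinearEquiv.ofInjective _ hinj).trans
      (LinearEquiv.ofEq _ _ (LinearMap.ker_compLeft_mkQ_span_singleton f).symm)
  have : Module.Finite R (LinearMap.ker π) := Module.Finite.equiv e
  have : Module.Projective R (LinearMap.ker π) := Module.Projective.of_equiv e
  obtain ⟨i, r, hri⟩ := LinearMap.exists_comp_eq_id_ker_of_surjective hφ hπ
  exact ⟨Module.Finite.of_surjective r fun x => ⟨i x, LinearMap.congr_fun hri x⟩,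
    Module.Projective.of_split i r hri⟩
end

section
/- Let R be a commutative ring, let r ≥ 1 and n be natural numbers, and let A : Matrix (Fin r) (Fin n) R. Assume that the ideal of (r-1)×(r-1) minors of A is the unit ideal. Then the annihilator of the cokernel (Fin r → R) ⧸ LinearMap.range A.mulVecLin equals the ideal of r×r minors of A. -/
/-- The ideal of `k × k` minors of a matrix `A`, generated by the determinants of all
`k × k` submatrices of `A`. For `k = 0` this is the unit ideal. -/
def minorsIdeal {R : Type*} [CommRing R] {m n : ℕ} (A : Matrix (Fin m) (Fin n) R)
    (k : ℕ) : Ideal R :=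
  Ideal.span {x | ∃ (f : Fin k → Fin m) (g : Fin k → Fin n), x = (A.submatrix f g).det}

/-- The ideal of maximal minors of `A` annihilates the cokernel of `A`. -/
theorem minorsIdeal_le_annihilator_coker {R : Type*} [CommRing R] {r n : ℕ}
    (A : Matrix (Fin r) (Fin n) R) :
    minorsIdeal A r ≤ Module.annihilator R ((Fin r → R) ⧸ LinearMap.range A.mulVecLin) := by
  refine Ideal.span_le.2 ?_
  rintro _ ⟨f, g, rfl⟩
  by_cases hf : Function.Injective f
  · let σ : Equiv.Perm (Fin r) := Equiv.ofBijective f hf.bijective_of_finite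
    have hdet : (A.submatrix f g).det = (Equiv.Perm.sign σ : ℤ) * (A.submatrix id g).det :=
      Matrix.det_permute σ (A.submatrix id g)
    rw [hdet]
    refine Ideal.mul_mem_left _ _ (Module.mem_annihilator.2 fun y => ?_)
    obtain ⟨v, rfl⟩ := Submodule.Quotient.mk_surjective _ y
    rw [← Submodule.Quotient.mk_smul, Submodule.Quotient.mk_eq_zero]
    have hv : (A.submatrix id g).mulVec ((A.submatrix id g).adjugate.mulVec v) =
        (A.submatrix id g).det • v := by
      rw [Matrix.mulVec_mulVec, Matrix.mul_adjugate, Matrix.smul_mulVec, Matrix.one_mulVec]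
    have hsub : A.submatrix id g = A * (1 : Matrix (Fin n) (Fin n) R).submatrix id g := by
      ext i j
      simp [Matrix.mul_apply, Matrix.one_apply]
    rw [← hv]
    nth_rw 1 [hsub]
    rw [← Matrix.mulVec_mulVec]
    exact ⟨_, rfl⟩
  · obtain ⟨i, j, hij, hne⟩ := Function.not_injective_iff.1 hf
    rw [Matrix.det_zero_of_row_eq hne (by ext; simp [hij])]
    exact Submodule.zero_mem _

/-- If `a • eᵢ` lies in the image of `A`, then the product of `a` with a `k × k` minor
of `A` avoiding the row `i` lies in the ideal of `(k + 1) × (k + 1)` minors. -/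
theorem mul_det_submatrix_mem_minorsIdeal {R : Type*} [CommRing R] {m n k : ℕ}
    (A : Matrix (Fin m) (Fin n) R) {a : R} {i : Fin m} {x : Fin n → R}
    (hx : A.mulVec x = a • Pi.single i 1) (f : Fin k → Fin m) (g : Fin k → Fin n)
    (hi : ∀ p, f p ≠ i) :
    a * (A.submatrix f g).det ∈ minorsIdeal A (k + 1) := by
  have key : a * (A.submatrix f g).det =
      ∑ j, x j * (A.submatrix (Fin.cons i f : Fin (k + 1) → Fin m)
        (Fin.cons j g : Fin (k + 1) → Fin n)).det := by
    have hrow (p : Fin m) : ∑ j, x j * A p j = if p = i then a else 0 := by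
      have := congrFun hx p
      simpa [Matrix.mulVec, dotProduct, Pi.single_apply, mul_comm] using this
    let c (p : Fin (k + 1)) : R := (-1) ^ (p : ℕ) *
      (A.submatrix ((Fin.cons i f : Fin (k + 1) → Fin m) ∘ p.succAbove) g).det
    have hdet (j : Fin n) : (A.submatrix (Fin.cons i f : Fin (k + 1) → Fin m)
        (Fin.cons j g : Fin (k + 1) → Fin n)).det =
        ∑ p, A ((Fin.cons i f : Fin (k + 1) → Fin m) p) j * c p := by
      rw [Matrix.det_succ_column_zero]
      refine Finset.sum_congr rfl fun p _ => ?_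
      simp only [c, Matrix.submatrix_submatrix, Matrix.submatrix_apply, Fin.cons_zero]
      rw [mul_comm ((-1) ^ (p : ℕ)), mul_assoc]
      rfl
    simp_rw [hdet, Finset.mul_sum, ← mul_assoc]
    rw [Finset.sum_comm]
    simp_rw [← Finset.sum_mul, hrow]
    rw [Fin.sum_univ_succ]
    simp only [Fin.cons_zero, Fin.cons_succ, hi, if_true, if_false, zero_mul,
      Finset.sum_const_zero, add_zero, c, Fin.val_zero, pow_zero, one_mul]
    rfl
  rw [key]
  exact Ideal.sum_mem _ fun j _ => Ideal.mul_mem_left _ _ (Ideal.subset_span ⟨_, _, rfl⟩)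

/-- If the submaximal minors of `A` generate the unit ideal, then the annihilator of the
cokernel of `A` is contained in the ideal of maximal minors. -/
theorem annihilator_coker_le_minorsIdeal {R : Type*} [CommRing R] {k n : ℕ}
    (A : Matrix (Fin (k + 1)) (Fin n) R) (h : minorsIdeal A k = ⊤) :
    Module.annihilator R ((Fin (k + 1) → R) ⧸ LinearMap.range A.mulVecLin) ≤
      minorsIdeal A (k + 1) := by
  intro a ha
  have hle : Ideal.span {a} * minorsIdeal A k ≤ minorsIdeal A (k + 1) := by
    refine Ideal.span_singleton_mul_le_iff.2 fun d hd => ?_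
    induction hd using Submodule.span_induction with
    | mem d hd =>
      obtain ⟨f, g, rfl⟩ := hd
      obtain ⟨i, hi⟩ : ∃ i, ∀ p, f p ≠ i := by
        by_contra! hf
        simpa using Fintype.card_le_of_surjective f hf
      have hmem := Module.mem_annihilator.1 ha (Submodule.Quotient.mk (Pi.single i 1))
      rw [← Submodule.Quotient.mk_smul, Submodule.Quotient.mk_eq_zero] at hmem
      obtain ⟨x, hx⟩ := hmem
      exact mul_det_submatrix_mem_minorsIdeal A hx f g hi
    | zero => simp
    | add d e _ _ hd he => rw [mul_add]; exact add_mem hd he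
    | smul s d _ hd => rw [smul_eq_mul, mul_left_comm]; exact Ideal.mul_mem_left _ _ hd
  rw [h, Ideal.mul_top] at hle
  exact hle (Ideal.mem_span_singleton_self a)

/-- If the `(r-1) × (r-1)` minors of an `r × n` matrix `A` generate the unit ideal, then
the annihilator of the cokernel of `A : Rⁿ → Rʳ` equals the ideal of `r × r` minors
of `A` (the degeneration scheme of `A` equals the scheme-theoretic support of the
cokernel). -/
theorem annihilator_coker_eq_minorsIdeal {R : Type*} [CommRing R] {r n : ℕ} (hr : 1 ≤ r)
    (A : Matrix (Fin r) (Fin n) R) (h : minorsIdeal A (r - 1) = ⊤) :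
    Module.annihilator R ((Fin r → R) ⧸ LinearMap.range A.mulVecLin) = minorsIdeal A r := by
  obtain ⟨k, rfl⟩ := Nat.exists_eq_add_of_le' hr
  exact le_antisymm (annihilator_coker_le_minorsIdeal A h) (minorsIdeal_le_annihilator_coker A)
end

section
/- Let R be a commutative ring, let r ≥ 1 and n be natural numbers, and let A : Matrix (Fin r) (Fin n) R. Assume that every r×r minor of A is zero and that the ideal of (r-1)×(r-1) minors of A is the unit ideal. Then the cokernel C := (Fin r → R) ⧸ LinearMap.range A.mulVecLin is a finitely generated projective R-module, and for every maximal ideal m of R, the (R ⧸ m)-vector space C ⧸ (m • C) has dimension 1. -/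
section LineBundleCriterion

variable {R M : Type*} [CommRing R] [AddCommGroup M] [Module R M]

/-- The ideal generated by the values `φ v` for which `φ v • id` is the rank one
endomorphism `w ↦ φ w • v`. -/
def rankOneIdeal (R M : Type*) [CommRing R] [AddCommGroup M] [Module R M] : Ideal R :=
  Ideal.span {a | ∃ (φ : M →ₗ[R] R) (v : M), φ v = a ∧ ∀ w, φ v • w = φ w • v}

theorem projective_of_rankOneIdeal_eq_top (h : rankOneIdeal R M = ⊤) :
    Module.Projective R M := by
  have key : ∀ a ∈ rankOneIdeal R M, ∃ s : M →ₗ[R] (M →₀ R),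
      ∀ w, Finsupp.linearCombination R id (s w) = a • w := by
    intro a ha
    induction ha using Submodule.span_induction with
    | mem a ha =>
      obtain ⟨φ, v, rfl, hv⟩ := ha
      exact ⟨(Finsupp.lsingle v).comp φ, fun w => by simp [hv]⟩
    | zero => exact ⟨0, fun w => by simp⟩
    | add a b _ _ ha hb =>
      obtain ⟨s, hs⟩ := ha
      obtain ⟨t, ht⟩ := hb
      exact ⟨s + t, fun w => by simp [hs, ht, add_smul]⟩
    | smul c a _ ha =>
      obtain ⟨s, hs⟩ := ha
      exact ⟨c • s, fun w => by simp [hs, mul_smul]⟩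
  obtain ⟨s, hs⟩ := key 1 (h ▸ Submodule.mem_top)
  exact ⟨s, fun w => by simpa using hs w⟩

theorem finrank_fiber_eq_one_of_rankOneIdeal_eq_top (h : rankOneIdeal R M = ⊤)
    (m : Ideal R) (hm : m.IsMaximal) :
    Module.finrank (R ⧸ m) (M ⧸ (m • ⊤ : Submodule R M)) = 1 := by
  let _ : Field (R ⧸ m) := Ideal.Quotient.field m
  obtain ⟨φ, v, hφ, hv⟩ : ∃ (φ : M →ₗ[R] R) (v : M), φ v ∉ m ∧ ∀ w, φ v • w = φ w • v := by
    by_contra! hcon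
    refine hm.ne_top (top_le_iff.mp (h ▸ Ideal.span_le.mpr ?_))
    rintro _ ⟨φ, v, rfl, hv⟩
    by_contra hmem
    obtain ⟨w, hw⟩ := hcon φ v hmem
    exact hw (hv w)
  have hle : (m • ⊤ : Submodule R M) ≤ Submodule.comap φ m :=
    Submodule.smul_le.mpr fun a ha w _ => by
      simpa using m.mul_mem_right (φ w) ha
  obtain ⟨b, hb⟩ := hm.exists_inv hφ
  obtain ⟨c, hc, hbc⟩ := hb
  refine finrank_eq_one (Submodule.Quotient.mk v) (fun h0 => ?_) fun w => ?_
  · exact hφ (hle ((Submodule.Quotient.mk_eq_zero _).mp h0))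
  · obtain ⟨w, rfl⟩ := Submodule.Quotient.mk_surjective _ w
    refine ⟨Ideal.Quotient.mk m (b * φ w), ?_⟩
    refine (Submodule.Quotient.eq _).mpr ?_
    have hw : (b * φ w) • v - w = -(c • w) := by
      rw [mul_smul, ← hv, ← mul_smul, eq_sub_of_add_eq hbc, sub_smul, one_smul]
      abel
    rw [hw]
    exact neg_mem (Submodule.smul_mem_smul hc trivial)

end LineBundleCriterion

section Cokernel

variable {R : Type*} [CommRing R] {k n : ℕ}

/-- The matrix with zero first column, followed by the columns of `A` selected by `g`. -/
def Matrix.zeroConsCols (A : Matrix (Fin (k + 1)) (Fin n) R) (g : Fin k → Fin n) :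
    Matrix (Fin (k + 1)) (Fin (k + 1)) R :=
  Matrix.of fun i => Fin.cons 0 fun j => A i (g j)

/-- The functional sending `x` to the determinant of the matrix whose columns are `x` and
the columns of `A` selected by `g`. -/
noncomputable def Matrix.detConsCols (A : Matrix (Fin (k + 1)) (Fin n) R) (g : Fin k → Fin n) :
    (Fin (k + 1) → R) →ₗ[R] R :=
  (LinearMap.proj 0).comp (A.zeroConsCols g).cramer

theorem Matrix.detConsCols_apply (A : Matrix (Fin (k + 1)) (Fin n) R) (g : Fin k → Fin n)
    (x : Fin (k + 1) → R) :
    A.detConsCols g x = ((A.zeroConsCols g).updateCol 0 x).det := by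
  simp [detConsCols, cramer_apply]

theorem Matrix.range_mulVecLin_le_ker_detConsCols (A : Matrix (Fin (k + 1)) (Fin n) R)
    (hzero : ∀ (f : Fin (k + 1) → Fin (k + 1)) (g : Fin (k + 1) → Fin n),
      (A.submatrix f g).det = 0) (g : Fin k → Fin n) :
    LinearMap.range A.mulVecLin ≤ LinearMap.ker (A.detConsCols g) := by
  rw [LinearMap.range_le_ker_iff]
  refine LinearMap.pi_ext' fun j => LinearMap.ext_ring ?_
  simp only [LinearMap.comp_apply, LinearMap.coe_single, mulVecLin_apply, mulVec_single_one,
    detConsCols_apply, LinearMap.zero_apply]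
  rw [← hzero id (Fin.cons j g)]
  congr 1
  ext i l
  refine Fin.cases ?_ (fun l => ?_) l <;> simp [zeroConsCols]

theorem Matrix.detConsCols_smul_sub_mem_range (A : Matrix (Fin (k + 1)) (Fin n) R)
    (g : Fin k → Fin n) (v x : Fin (k + 1) → R) :
    A.detConsCols g v • x - A.detConsCols g x • v ∈ LinearMap.range A.mulVecLin := by
  set N := (A.zeroConsCols g).updateCol 0 v with hN
  have hx : A.detConsCols g x = N.cramer x 0 := by
    rw [detConsCols_apply, cramer_apply, hN, updateCol_idem]
  have hsum : A.detConsCols g v • x - A.detConsCols g x • v =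
      ∑ j : Fin k, N.cramer x j.succ • A.mulVecLin (Pi.single (g j) 1) := by
    simp only [mulVecLin_apply, mulVec_single_one]
    rw [hx, detConsCols_apply, ← hN, ← mulVec_cramer N x]
    ext i
    have hcol : ∀ l : Fin k, N i l.succ = A i (g l) := fun l => by simp [hN, zeroConsCols]
    have hcol0 : N i 0 = v i := by simp [hN]
    simp [mulVec_eq_sum, Fin.sum_univ_succ, hcol, hcol0]
  rw [hsum]
  exact Submodule.sum_mem _ fun j _ => Submodule.smul_mem _ _ ⟨_, rfl⟩

theorem Matrix.exists_detConsCols_eq_det_submatrix (A : Matrix (Fin (k + 1)) (Fin n) R)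
    (f : Fin k → Fin (k + 1)) (g : Fin k → Fin n) :
    ∃ v, A.detConsCols g v = (A.submatrix f g).det := by
  by_cases hf : Function.Injective f
  · obtain ⟨i, hi⟩ : ∃ i, i ∉ Set.range f := by
      by_contra! hcon
      simpa using Fintype.card_le_of_surjective f hcon
    have hσ : Function.Bijective (Fin.cons i f : Fin (k + 1) → Fin (k + 1)) :=
      Finite.injective_iff_bijective.mp (Fin.cons_injective_iff.mpr ⟨hi, hf⟩)
    let σ := Equiv.ofBijective _ hσ
    have hdet : (((A.zeroConsCols g).updateCol 0 (Pi.single i 1)).submatrix σ id).det =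
        (A.submatrix f g).det := by
      have hne : ∀ l, f l ≠ i := fun l hl => hi ⟨l, hl⟩
      rw [det_succ_column_zero, Fin.sum_univ_succ]
      simp [σ, hne, zeroConsCols]
      rfl
    refine ⟨((Equiv.Perm.sign σ : ℤ) : R) • Pi.single i 1, ?_⟩
    rw [map_smul, detConsCols_apply, ← hdet, det_permute, smul_eq_mul]
  · obtain ⟨a, b, hab, hne⟩ := Function.not_injective_iff.mp hf
    exact ⟨0, by rw [map_zero, det_zero_of_row_eq hne (by ext; simp [hab])]⟩

theorem minorsIdeal_le_rankOneIdeal_coker (A : Matrix (Fin (k + 1)) (Fin n) R)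
    (hzero : ∀ (f : Fin (k + 1) → Fin (k + 1)) (g : Fin (k + 1) → Fin n),
      (A.submatrix f g).det = 0) :
    minorsIdeal A k ≤ rankOneIdeal R ((Fin (k + 1) → R) ⧸ LinearMap.range A.mulVecLin) := by
  refine Ideal.span_mono ?_
  rintro _ ⟨f, g, rfl⟩
  obtain ⟨v, hv⟩ := A.exists_detConsCols_eq_det_submatrix f g
  refine ⟨(LinearMap.range A.mulVecLin).liftQ (A.detConsCols g)
    (A.range_mulVecLin_le_ker_detConsCols hzero g), Submodule.Quotient.mk v, hv, fun w => ?_⟩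
  obtain ⟨x, rfl⟩ := Submodule.Quotient.mk_surjective _ w
  exact (Submodule.Quotient.eq _).mpr (A.detConsCols_smul_sub_mem_range g v x)

end Cokernel

/-- If all `r × r` minors of an `r × n` matrix `A` vanish while the `(r-1) × (r-1)`
minors generate the unit ideal, then the cokernel of `A : Rⁿ → Rʳ` is a finitely
generated projective module whose fiber at every maximal ideal is one-dimensional
(i.e., the cokernel is a line bundle). -/
theorem coker_is_line_bundle {R : Type*} [CommRing R] {r n : ℕ} (hr : 1 ≤ r)
    (A : Matrix (Fin r) (Fin n) R)
    (hzero : ∀ (f : Fin r → Fin r) (g : Fin r → Fin n), (A.submatrix f g).det = 0)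
    (h : minorsIdeal A (r - 1) = ⊤) :
    Module.Finite R ((Fin r → R) ⧸ LinearMap.range A.mulVecLin) ∧
    Module.Projective R ((Fin r → R) ⧸ LinearMap.range A.mulVecLin) ∧
    ∀ m : Ideal R, m.IsMaximal →
      Module.finrank (R ⧸ m)
        (((Fin r → R) ⧸ LinearMap.range A.mulVecLin) ⧸
          (m • ⊤ : Submodule R ((Fin r → R) ⧸ LinearMap.range A.mulVecLin))) = 1 := by
  obtain ⟨k, rfl⟩ := Nat.exists_eq_add_of_le' hr
  have htop : rankOneIdeal R ((Fin (k + 1) → R) ⧸ LinearMap.range A.mulVecLin) = ⊤ :=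
    top_le_iff.mp (h ▸ minorsIdeal_le_rankOneIdeal_coker A hzero)
  exact ⟨inferInstance, projective_of_rankOneIdeal_eq_top htop,
    finrank_fiber_eq_one_of_rankOneIdeal_eq_top htop⟩
end

section
/- Let R be a commutative ring, let f ∈ R be a non-zerodivisor, let M, N, F be R-modules, and let φ : M →ₗ[R] N be an R-linear map such that f • y ∈ LinearMap.range φ for every y ∈ N (i.e., the cokernel of φ is annihilated by f). Assume that multiplication by f is injective on F (f • x = 0 implies x = 0; this holds for instance when F is free). Then the map Hom_R(N, F) → Hom_R(M, F), ψ ↦ ψ ∘ φ, is injective; equivalently, if a linear map M → F factors through φ, the factorization is unique. -/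
/-- If the cokernel of `φ : M →ₗ[R] N` is annihilated by a non-zerodivisor `f` and
multiplication by `f` is injective on `F`, then composition with `φ` is injective on
`Hom(N, F)`: a factorization of a map `M → F` through `φ` is unique. -/
theorem comp_injective_of_coker_torsion {R : Type*} [CommRing R]
    (f : R) (hf : f ∈ nonZeroDivisors R)
    {M N F : Type*} [AddCommGroup M] [Module R M] [AddCommGroup N] [Module R N]
    [AddCommGroup F] [Module R F]
    (φ : M →ₗ[R] N) (hcoker : ∀ y : N, f • y ∈ LinearMap.range φ)
    (hF : ∀ x : F, f • x = 0 → x = 0) :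
    Function.Injective (fun ψ : N →ₗ[R] F => ψ.comp φ) := by
  intro ψ₁ ψ₂ h
  ext y
  obtain ⟨x, hx⟩ := hcoker y
  refine sub_eq_zero.mp (hF _ ?_)
  rw [smul_sub, ← map_smul, ← map_smul, ← hx, sub_eq_zero]
  exact LinearMap.congr_fun h x
end

section
/- Let R be a commutative ring, let f ∈ R be a non-zerodivisor, let m, n, r be natural numbers with r ≥ 1, and let A : Matrix (Fin m) (Fin n) R. Assume: (i) every (r+1)×(r+1) minor of A is zero; (ii) the ideal of r×r minors of A equals Ideal.span {f}; (iii) the ideal of (r-1)×(r-1) minors of A is the unit ideal. Then there exist finitely generated projective R-modules M₁ and N₁ such that for every maximal ideal m of R, the fibers M₁ ⧸ (m • M₁) and N₁ ⧸ (m • N₁) have dimension r over R ⧸ m; a surjective R-linear map π : (Fin n → R) → M₁; an R-linear map ι : N₁ → (Fin m → R) whose induced map on fibers at every maximal ideal is injective; and an injective R-linear map φ₁ : M₁ → N₁, such that A.mulVecLin = ι ∘ φ₁ ∘ π and the cokernel C := N₁ ⧸ range φ₁ satisfies: f • C = 0, and C, viewed as a module over R ⧸ Ideal.span {f}, is finitely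 generated projective with all fibers of dimension 1. -/
universe u

/-- The data of a canonical factorization `A = ι ∘ φ₁ ∘ π` of the map
`A : Rⁿ → Rᵐ` given by a matrix `A` of rank `r`:
`π : Rⁿ ↠ M₁` is an epimorphism, `ι : N₁ → Rᵐ` is a fiberwise monomorphism,
`M₁` and `N₁` are finitely generated projective modules with all fibers of
dimension `r`, and `φ₁ : M₁ → N₁` is a monomorphism whose cokernel is a line
bundle on the Cartier divisor cut out by `f`. -/
structure CanonicalFactorization {R : Type u} [CommRing R] (f : R) {m n : ℕ} (r : ℕ)
    (A : Matrix (Fin m) (Fin n) R) where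
  M₁ : Type u
  N₁ : Type u
  [addM : AddCommGroup M₁]
  [modM : Module R M₁]
  [addN : AddCommGroup N₁]
  [modN : Module R N₁]
  finM : Module.Finite R M₁
  projM : Module.Projective R M₁
  finN : Module.Finite R N₁
  projN : Module.Projective R N₁
  fiberDimM : ∀ p : Ideal R, p.IsMaximal →
    Module.finrank (R ⧸ p) (M₁ ⧸ (p • ⊤ : Submodule R M₁)) = r
  fiberDimN : ∀ p : Ideal R, p.IsMaximal →
    Module.finrank (R ⧸ p) (N₁ ⧸ (p • ⊤ : Submodule R N₁)) = r
  π : (Fin n → R) →ₗ[R] M₁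
  hπ : Function.Surjective π
  ι : N₁ →ₗ[R] (Fin m → R)
  hι : ∀ p : Ideal R, p.IsMaximal → Function.Injective (fiberMap ι p)
  φ₁ : M₁ →ₗ[R] N₁
  hφ₁ : Function.Injective φ₁
  factorization : A.mulVecLin = ι ∘ₗ φ₁ ∘ₗ π
  /-- The cokernel `C = N₁ ⧸ range φ₁` is annihilated by `f`. -/
  cokerTorsion : Module.IsTorsionBy R (N₁ ⧸ LinearMap.range φ₁) f
  /-- The cokernel, viewed as a module over `R ⧸ (f)`, is finitely generated
  projective with all fibers of dimension `1` (i.e., a line bundle on the divisor). -/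
  cokerLineBundle :
    letI : Module (R ⧸ Ideal.span {f}) (N₁ ⧸ LinearMap.range φ₁) := cokerTorsion.module
    Module.Finite (R ⧸ Ideal.span {f}) (N₁ ⧸ LinearMap.range φ₁) ∧
    Module.Projective (R ⧸ Ideal.span {f}) (N₁ ⧸ LinearMap.range φ₁) ∧
    ∀ q : Ideal (R ⧸ Ideal.span {f}), q.IsMaximal →
      Module.finrank ((R ⧸ Ideal.span {f}) ⧸ q)
        ((N₁ ⧸ LinearMap.range φ₁) ⧸
          (q • ⊤ : Submodule (R ⧸ Ideal.span {f}) (N₁ ⧸ LinearMap.range φ₁))) = 1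

/-- The determinant of a block matrix with top left block `M`, expanded by means of the adjugate
of `M`: multiplying by `M.det` avoids inverting `M`. -/
lemma det_fromBlocks_mul_det {R : Type*} [CommRing R] {k : ℕ}
    (M : Matrix (Fin k) (Fin k) R) (B : Matrix (Fin k) (Fin 1) R) (C : Matrix (Fin 1) (Fin k) R)
    (D : Matrix (Fin 1) (Fin 1) R) :
    (Matrix.fromBlocks M B C D).det * M.det =
      M.det * (M.det • D - C * M.adjugate * B).det := by
  have h : Matrix.fromBlocks M B C D *
      Matrix.fromBlocks 1 (-(M.adjugate * B)) 0 (M.det • (1 : Matrix (Fin 1) (Fin 1) R)) =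
      Matrix.fromBlocks M 0 C (M.det • D - C * M.adjugate * B) := by
    rw [Matrix.fromBlocks_multiply]
    congr 1
    · simp
    · rw [Matrix.mul_neg, ← Matrix.mul_assoc, Matrix.mul_adjugate]
      simp
    · simp
    · rw [Matrix.mul_neg, ← Matrix.mul_assoc]
      simp [sub_eq_neg_add]
  have h' := congrArg Matrix.det h
  rw [Matrix.det_mul, Matrix.det_fromBlocks_zero₂₁, Matrix.det_fromBlocks_zero₁₂] at h'
  simpa using h'

/-- The determinant of a bordered matrix in terms of the adjugate. -/
lemma det_fromBlocks_adjugate {R : Type*} [CommRing R] {k : ℕ}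
    (M : Matrix (Fin k) (Fin k) R) (B : Matrix (Fin k) (Fin 1) R) (C : Matrix (Fin 1) (Fin k) R)
    (D : Matrix (Fin 1) (Fin 1) R) :
    (Matrix.fromBlocks M B C D).det = (M.det • D - C * M.adjugate * B).det := by
  let c : R →+* Polynomial R := Polynomial.C
  let e : Polynomial R →+* R := Polynomial.evalRingHom 0
  have hM : (Matrix.charmatrix (-M)).map e = M := by
    ext i j
    by_cases hij : i = j <;> simp [e, hij]
  have hc {a b : ℕ} (N : Matrix (Fin a) (Fin b) R) : (N.map c).map e = N := by
    ext i j
    simp [c, e]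
  have hcancel : IsRightRegular (Matrix.charmatrix (-M)).det :=
    (Matrix.charpoly_monic (-M)).isRegular.right
  have h := hcancel ((det_fromBlocks_mul_det (Matrix.charmatrix (-M)) (B.map c) (C.map c)
    (D.map c)).trans (mul_comm _ _))
  have h' := congrArg e h
  simp only [RingHom.map_det, RingHom.mapMatrix_apply, Matrix.fromBlocks_map] at h'
  rw [hM, hc, hc, hc] at h'
  rw [h']
  congr 1
  have hadj : (Matrix.charmatrix (-M)).adjugate.map e = M.adjugate := by
    rw [← RingHom.mapMatrix_apply, RingHom.map_adjugate, RingHom.mapMatrix_apply, hM]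
  have hdet : e (Matrix.charmatrix (-M)).det = M.det := by
    rw [RingHom.map_det, RingHom.mapMatrix_apply, hM]
  rw [Matrix.map_sub _ (by simp), Matrix.map_mul, Matrix.map_mul, hadj, hc, hc]
  congr 1
  ext i j
  change e ((Matrix.charmatrix (-M)).det * c (D i j)) = M.det * D i j
  rw [map_mul, hdet]
  simp [c, e]

section Minors

variable {R : Type*} [CommRing R] {m n : ℕ}

lemma det_submatrix_mem_minorsIdeal (A : Matrix (Fin m) (Fin n) R) {k : ℕ}
    (I : Fin k → Fin m) (J : Fin k → Fin n) : (A.submatrix I J).det ∈ minorsIdeal A k :=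
  Ideal.subset_span ⟨I, J, rfl⟩

lemma minorsIdeal_le_iff (A : Matrix (Fin m) (Fin n) R) {k : ℕ} {K : Ideal R} :
    minorsIdeal A k ≤ K ↔
      ∀ (I : Fin k → Fin m) (J : Fin k → Fin n), (A.submatrix I J).det ∈ K := by
  refine ⟨fun h I J ↦ h (det_submatrix_mem_minorsIdeal A I J), fun h ↦ Ideal.span_le.2 ?_⟩
  rintro _ ⟨I, J, rfl⟩
  exact h I J

lemma minorsIdeal_transpose (A : Matrix (Fin m) (Fin n) R) (k : ℕ) :
    minorsIdeal A.transpose k = minorsIdeal A k := by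
  apply le_antisymm
  · refine (minorsIdeal_le_iff _).2 fun I J ↦ ?_
    rw [← Matrix.transpose_submatrix, Matrix.det_transpose]
    exact det_submatrix_mem_minorsIdeal A J I
  · refine (minorsIdeal_le_iff _).2 fun I J ↦ ?_
    rw [← Matrix.det_transpose, Matrix.transpose_submatrix]
    exact det_submatrix_mem_minorsIdeal _ J I

lemma minorsIdeal_map {S : Type*} [CommRing S] (φ : R →+* S) (A : Matrix (Fin m) (Fin n) R)
    (k : ℕ) : minorsIdeal (A.map φ) k = (minorsIdeal A k).map φ := by
  have h (I : Fin k → Fin m) (J : Fin k → Fin n) :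
      ((A.map φ).submatrix I J).det = φ (A.submatrix I J).det := by
    rw [RingHom.map_det, RingHom.mapMatrix_apply, Matrix.submatrix_map]
  apply le_antisymm
  · refine (minorsIdeal_le_iff _).2 fun I J ↦ ?_
    rw [h]
    exact Ideal.mem_map_of_mem φ (det_submatrix_mem_minorsIdeal A I J)
  · refine Ideal.map_le_iff_le_comap.2 ((minorsIdeal_le_iff _).2 fun I J ↦ ?_)
    rw [Ideal.mem_comap, ← h]
    exact det_submatrix_mem_minorsIdeal _ I J

/-- A weak form of the Cauchy–Binet formula. -/
lemma minorsIdeal_mul_le {l : ℕ} (A : Matrix (Fin l) (Fin m) R) (B : Matrix (Fin m) (Fin n) R)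
    (k : ℕ) : minorsIdeal (A * B) k ≤ minorsIdeal A k * minorsIdeal B k := by
  refine (minorsIdeal_le_iff _).2 fun I J ↦ ?_
  let U : Matrix (Fin k) (Fin m) R := A.submatrix I id
  let v : Fin k → Fin m → R := (B.submatrix id J).transpose
  let g : (Fin m → R) [⋀^Fin k]→ₗ[R] R := Matrix.detRowAlternating.compLinearMap U.mulVecLin
  have hg : ((A * B).submatrix I J).det = g v := by
    rw [← Matrix.det_transpose]
    rfl
  have hsum := (((Pi.basisFun R (Fin m)).exteriorPower k).sum_repr (exteriorPower.ιMulti R k v))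
  have hg' : g v = exteriorPower.alternatingMapLinearEquiv g (exteriorPower.ιMulti R k v) := by
    simp
  rw [hg, hg', ← hsum, map_sum]
  refine Ideal.sum_mem _ fun s _ ↦ ?_
  rw [map_smul, smul_eq_mul, mul_comm (Module.Basis.repr _ _ _)]
  refine Ideal.mul_mem_mul ?_ ?_
  · rw [exteriorPower.basis_apply, exteriorPower.ιMulti_family,
      exteriorPower.alternatingMapLinearEquiv_apply_ιMulti]
    convert det_submatrix_mem_minorsIdeal A I (Set.powersetCard.ofFinEmbEquiv.symm s) using 1
    rw [← Matrix.det_transpose]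
    change Matrix.det _ = Matrix.det _
    congr 1
    ext i j
    simp [U, Matrix.mulVec_single]
  · rw [exteriorPower.basis_repr_apply, exteriorPower.ιMultiDual_apply_ιMulti]
    convert det_submatrix_mem_minorsIdeal B (Set.powersetCard.ofFinEmbEquiv.symm s) J using 1
    rw [← Matrix.det_transpose]
    congr 1

lemma le_rank_of_minorsIdeal_eq_top {K : Type*} [Field K] {k : ℕ} (A : Matrix (Fin m) (Fin n) K)
    (h : minorsIdeal A k = ⊤) : k ≤ A.rank := by
  by_contra! hlt
  have : minorsIdeal A k ≤ ⊥ := by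
    refine (minorsIdeal_le_iff _).2 fun I J ↦ ?_
    rw [Ideal.mem_bot]
    by_contra hdet
    have h1 : (A.submatrix I J).rank = k := by
      simpa using Matrix.rank_of_det_ne_zero hdet
    have h2 : A.submatrix I J = (1 : Matrix (Fin m) (Fin m) K).submatrix I id * A *
        (1 : Matrix (Fin n) (Fin n) K).submatrix id J := by
      ext i j
      simp [Matrix.mul_apply, Matrix.one_apply]
    rw [← h1, h2] at hlt
    exact hlt.not_ge ((Matrix.rank_mul_le_left _ _).trans (Matrix.rank_mul_le_right _ _))
  exact top_ne_bot (h.symm.trans (le_bot_iff.1 this))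

lemma rank_lt_of_minorsIdeal_eq_bot {K : Type*} [Field K] {k : ℕ} (A : Matrix (Fin m) (Fin n) K)
    (h : minorsIdeal A k = ⊥) : A.rank < k := by
  by_contra! hle
  obtain ⟨y, hy⟩ := exists_linearIndependent_of_le_finrank
    (R := K) (M := LinearMap.range A.mulVecLin) hle
  choose x hx using fun i ↦ (y i).2
  have hy' : LinearIndependent K fun i ↦ ((y i : Fin m → K)) :=
    hy.map' (LinearMap.range A.mulVecLin).subtype (Submodule.ker_subtype _)
  obtain ⟨u, hu⟩ := LinearMap.exists_leftInverse_of_injective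
    (Fintype.linearCombination K fun i ↦ ((y i : Fin m → K)))
    (LinearMap.ker_eq_bot.2 hy'.fintypeLinearCombination_injective)
  have hone : LinearMap.toMatrix' u * (A * (Matrix.of x).transpose) = 1 := by
    apply (Matrix.toLin' (R := K)).injective
    rw [Matrix.toLin'_mul, Matrix.toLin'_toMatrix', Matrix.toLin'_one, ← hu]
    congr 1
    refine LinearMap.pi_ext' fun i ↦ LinearMap.ext_ring ?_
    rw [LinearMap.comp_apply, LinearMap.comp_apply, LinearMap.single_apply,
      Fintype.linearCombination_apply_single, one_smul, ← hx, Matrix.toLin'_mul,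
      LinearMap.comp_apply, Matrix.toLin'_apply, Matrix.toLin'_apply, Matrix.mulVec_single_one]
    rfl
  have h1 : (1 : K) ∈ minorsIdeal (LinearMap.toMatrix' u * (A * (Matrix.of x).transpose)) k := by
    have := det_submatrix_mem_minorsIdeal (LinearMap.toMatrix' u * (A * (Matrix.of x).transpose))
      (id : Fin k → Fin k) id
    rw [hone] at this ⊢
    simpa using this
  have h2 := minorsIdeal_mul_le _ _ _ h1
  have h3 := minorsIdeal_mul_le _ _ _ (Ideal.mul_le_right h2)
  rw [h, Ideal.bot_mul, Ideal.mem_bot] at h3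
  exact one_ne_zero h3

/-- The vanishing of the `(k + 1) × (k + 1)` minors makes each element of the ideal of
`k × k` minors a denominator for a generalized inverse. -/
lemma exists_generalizedInverse (A : Matrix (Fin m) (Fin n) R) {k : ℕ}
    (h : minorsIdeal A (k + 1) = ⊥) {x : R} (hx : x ∈ minorsIdeal A k) :
    ∃ G : Matrix (Fin n) (Fin m) R, A * G * A = x • A ∧
      (∀ i j, (A * G) i j ∈ minorsIdeal A k) ∧ ∀ i j, (G * A) i j ∈ minorsIdeal A k := by
  induction hx using Submodule.span_induction with
  | zero => exact ⟨0, by simp, by simp, by simp⟩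
  | add x y _ _ hx hy =>
    obtain ⟨G, h1, h2, h3⟩ := hx
    obtain ⟨H, h1', h2', h3'⟩ := hy
    refine ⟨G + H, ?_, fun i j ↦ ?_, fun i j ↦ ?_⟩
    · rw [Matrix.mul_add, Matrix.add_mul, h1, h1', add_smul]
    · rw [Matrix.mul_add]
      exact add_mem (h2 i j) (h2' i j)
    · rw [Matrix.add_mul]
      exact add_mem (h3 i j) (h3' i j)
  | smul a x _ hx =>
    obtain ⟨G, h1, h2, h3⟩ := hx
    refine ⟨a • G, ?_, fun i j ↦ ?_, fun i j ↦ ?_⟩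
    · rw [Matrix.mul_smul, Matrix.smul_mul, h1, smul_smul, smul_eq_mul]
    · rw [Matrix.mul_smul]
      exact Ideal.mul_mem_left _ a (h2 i j)
    · rw [Matrix.smul_mul]
      exact Ideal.mul_mem_left _ a (h3 i j)
  | mem x hx =>
    obtain ⟨I, J, rfl⟩ := hx
    let S : Matrix (Fin k) (Fin m) R := (1 : Matrix (Fin m) (Fin m) R).submatrix I id
    let T : Matrix (Fin n) (Fin k) R := (1 : Matrix (Fin n) (Fin n) R).submatrix id J
    have hS : S * A = A.submatrix I id := by
      ext i j
      simp [S, Matrix.mul_apply, Matrix.one_apply]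
    have hT : A * T = A.submatrix id J := by
      ext i j
      simp [T, Matrix.mul_apply, Matrix.one_apply]
    refine ⟨T * (A.submatrix I J).adjugate * S, ?_, fun i j ↦ ?_, fun i j ↦ ?_⟩
    · rw [← Matrix.mul_assoc, ← Matrix.mul_assoc, Matrix.mul_assoc _ S, hS, hT]
      ext i j
      have hdet := det_fromBlocks_adjugate (A.submatrix I J) (A.submatrix I fun _ ↦ j)
        (A.submatrix (fun _ ↦ i) J) (A.submatrix (fun _ ↦ i) fun _ ↦ j)
      have hzero : (Matrix.fromBlocks (A.submatrix I J) (A.submatrix I fun _ : Fin 1 ↦ j)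
        (A.submatrix (fun _ : Fin 1 ↦ i) J) (A.submatrix (fun _ ↦ i) fun _ ↦ j)).det = 0 := by
        rw [← Matrix.det_submatrix_equiv_self finSumFinEquiv.symm, ← Ideal.mem_bot, ← h]
        convert det_submatrix_mem_minorsIdeal A
          (Sum.elim I (fun _ : Fin 1 ↦ i) ∘ finSumFinEquiv.symm)
          (Sum.elim J (fun _ : Fin 1 ↦ j) ∘ finSumFinEquiv.symm) using 2
        rw [← Matrix.submatrix_submatrix]
        congr 1
        ext (a | a) (b | b) <;> rfl
      rw [hzero, Matrix.det_fin_one, Matrix.sub_apply, eq_comm, sub_eq_zero] at hdet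
      exact hdet.symm
    · rw [← Matrix.mul_assoc, ← Matrix.mul_assoc, hT, Matrix.mul_apply]
      refine Ideal.sum_mem _ fun l _ ↦ Ideal.mul_mem_right _ _ ?_
      convert det_submatrix_mem_minorsIdeal A (Function.update I l i) J using 1
      have := Matrix.cramer_transpose_apply (A.submatrix I J) (A.submatrix id J i) l
      rw [Matrix.cramer_eq_adjugate_mulVec, ← Matrix.adjugate_transpose,
        Matrix.mulVec_transpose] at this
      refine Eq.trans this (congrArg Matrix.det ?_)
      ext a b
      by_cases hal : a = l
      · subst hal; simp
      · simp [hal]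
    · rw [Matrix.mul_assoc, hS, Matrix.mul_assoc, Matrix.mul_apply]
      refine Ideal.sum_mem _ fun l _ ↦ Ideal.mul_mem_left _ _ ?_
      convert det_submatrix_mem_minorsIdeal A I (Function.update J l j) using 1
      have := Matrix.cramer_apply (A.submatrix I J) (fun a ↦ A (I a) j) l
      rw [Matrix.cramer_eq_adjugate_mulVec] at this
      refine Eq.trans this (congrArg Matrix.det ?_)
      ext a b
      by_cases hal : b = l
      · subst hal; simp
      · simp [hal]

end Minors

section Idempotent

variable {R : Type*} [CommRing R] {m n : ℕ}

lemma smul_left_cancel_of_mem_nonZeroDivisors {f : R} (hf : f ∈ nonZeroDivisors R)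
    {X Y : Matrix (Fin m) (Fin n) R} (h : f • X = f • Y) : X = Y := by
  ext i j
  exact (mul_cancel_left_mem_nonZeroDivisors hf).1 (congrFun (congrFun h i) j)

/-- If the `k × k` minors of `A` generate the ideal of a non-zerodivisor `f` and the larger minors
vanish, the saturations of the images of `A` and of its transpose are cut out by idempotents. -/
lemma exists_idempotents {f : R} (hf : f ∈ nonZeroDivisors R) {k : ℕ}
    (A : Matrix (Fin m) (Fin n) R) (h1 : minorsIdeal A (k + 1) = ⊥)
    (h2 : minorsIdeal A k = Ideal.span {f}) :
    ∃ (G : Matrix (Fin n) (Fin m) R) (P : Matrix (Fin m) (Fin m) R)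
      (Q : Matrix (Fin n) (Fin n) R), A * G = f • P ∧ G * A = f • Q ∧ P * A = A ∧ A * Q = A ∧
        P * P = P ∧ Q * Q = Q := by
  obtain ⟨G, hG, hP, hQ⟩ := exists_generalizedInverse A h1 (x := f)
    (h2 ▸ Ideal.mem_span_singleton_self f)
  simp only [h2, Ideal.mem_span_singleton] at hP hQ
  choose P hP using hP
  choose Q hQ using hQ
  replace hP : A * G = f • Matrix.of P := by ext i j; simp [hP]
  replace hQ : G * A = f • Matrix.of Q := by ext i j; simp [hQ]
  have hPA : Matrix.of P * A = A := by
    apply smul_left_cancel_of_mem_nonZeroDivisors hf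
    rw [← Matrix.smul_mul, ← hP, hG]
  have hAQ : A * Matrix.of Q = A := by
    apply smul_left_cancel_of_mem_nonZeroDivisors hf
    rw [← Matrix.mul_smul, ← hQ, ← Matrix.mul_assoc, hG]
  refine ⟨G, Matrix.of P, Matrix.of Q, hP, hQ, hPA, hAQ, ?_, ?_⟩
  · apply smul_left_cancel_of_mem_nonZeroDivisors hf
    rw [← Matrix.mul_smul, ← hP, ← Matrix.mul_assoc, hPA]
  · apply smul_left_cancel_of_mem_nonZeroDivisors hf
    rw [← Matrix.smul_mul, ← hQ, Matrix.mul_assoc, hAQ]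

lemma rank_map_saturation {f : R} (hf : f ∈ nonZeroDivisors R) {k : ℕ}
    {A : Matrix (Fin m) (Fin n) R} (h1 : minorsIdeal A (k + 1) = ⊥)
    (h2 : minorsIdeal A k = Ideal.span {f}) {G : Matrix (Fin n) (Fin m) R}
    {P : Matrix (Fin m) (Fin m) R} (hG : A * G = f • P) (hP : P * A = A)
    {K : Type*} [Field K] (φ : R →+* K) : (P.map φ).rank = k := by
  apply le_antisymm
  · refine Nat.lt_succ_iff.1 (rank_lt_of_minorsIdeal_eq_bot _ ?_)
    rw [minorsIdeal_map, Ideal.map_eq_bot_iff_le_ker]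
    refine ((minorsIdeal_le_iff (K := ⊥) _).2 fun I J ↦ ?_).trans bot_le
    have h := minorsIdeal_mul_le A G (k + 1) (det_submatrix_mem_minorsIdeal (A * G) I J)
    rw [h1, Ideal.bot_mul, hG, Matrix.submatrix_smul, Pi.smul_apply, Pi.smul_apply,
      Matrix.det_smul, Ideal.mem_bot, mul_comm] at h
    exact mem_nonZeroDivisors_iff_right.1 (pow_mem hf _) _ h
  · apply le_rank_of_minorsIdeal_eq_top
    rw [minorsIdeal_map, (Ideal.eq_top_iff_one (minorsIdeal P k)).2 ?_, Ideal.map_top]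
    have h := minorsIdeal_mul_le P A k
    rw [hP, h2] at h
    obtain ⟨z, hz, hzf⟩ := Ideal.mem_mul_span_singleton.1 (h (Ideal.mem_span_singleton_self f))
    rwa [← (mul_cancel_right_mem_nonZeroDivisors hf).1 (hzf.trans (one_mul f).symm)]

/-- A module embedded as the range of an idempotent matrix is a direct summand. -/
lemma exists_retraction {M : Type*} [AddCommGroup M] [Module R M] {F : Matrix (Fin m) (Fin m) R}
    (hF : F * F = F) (i : M →ₗ[R] (Fin m → R)) (hi : Function.Injective i)
    (hr : LinearMap.range i = LinearMap.range F.mulVecLin) :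
    ∃ ρ : (Fin m → R) →ₗ[R] M, ρ ∘ₗ i = LinearMap.id ∧ i ∘ₗ ρ = F.mulVecLin := by
  let ρ : (Fin m → R) →ₗ[R] M := (LinearEquiv.ofInjective i hi).symm.toLinearMap ∘ₗ
    F.mulVecLin.codRestrict (LinearMap.range i) fun x ↦ hr ▸ LinearMap.mem_range_self _ x
  have hρ (x) : i (ρ x) = F.mulVecLin x :=
    congrArg Subtype.val ((LinearEquiv.ofInjective i hi).apply_symm_apply _)
  refine ⟨ρ, LinearMap.ext fun x ↦ hi ?_, LinearMap.ext hρ⟩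
  obtain ⟨y, hy⟩ : i x ∈ LinearMap.range F.mulVecLin := hr ▸ LinearMap.mem_range_self i x
  rw [LinearMap.comp_apply, hρ, LinearMap.id_apply, ← hy, ← LinearMap.comp_apply,
    ← Matrix.mulVecLin_mul, hF]

lemma finrank_fiber {M : Type*} [AddCommGroup M] [Module R M] {F : Matrix (Fin m) (Fin m) R}
    {i : M →ₗ[R] (Fin m → R)} {ρ : (Fin m → R) →ₗ[R] M} (h1 : ρ ∘ₗ i = LinearMap.id)
    (h2 : i ∘ₗ ρ = F.mulVecLin) (p : Ideal R) :
    Module.finrank (R ⧸ p) (M ⧸ (p • ⊤ : Submodule R M)) =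
      (F.map (Ideal.Quotient.mk p)).rank := by
  let q : (Fin m → R) →ₗ[R] (Fin m → R ⧸ p) :=
    (Ideal.Quotient.mkₐ R p).toLinearMap.compLeft (Fin m)
  have hq (x j) : q x j = Ideal.Quotient.mk p (x j) := rfl
  have hqF (x) : q (F.mulVecLin x) = (F.map (Ideal.Quotient.mk p)).mulVecLin (q x) := by
    ext j
    simp [hq, Matrix.mulVec, dotProduct]
  have hρi (x) : ρ (i x) = x := LinearMap.congr_fun h1 x
  have hiρ (x) : i (ρ x) = F.mulVecLin x := LinearMap.congr_fun h2 x
  have hker : (p • ⊤ : Submodule R M) ≤ LinearMap.ker (q ∘ₗ i) := by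
    refine Submodule.smul_le.2 fun a ha x _ ↦ ?_
    rw [LinearMap.mem_ker, map_smul]
    ext j
    rw [Pi.smul_apply, Algebra.smul_def, Ideal.Quotient.algebraMap_eq,
      Ideal.Quotient.eq_zero_iff_mem.2 ha, zero_mul, Pi.zero_apply]
  let a₀ : (M ⧸ (p • ⊤ : Submodule R M)) →ₗ[R] (Fin m → R ⧸ p) := Submodule.liftQ _ (q ∘ₗ i) hker
  let a : (M ⧸ (p • ⊤ : Submodule R M)) →ₗ[R ⧸ p] (Fin m → R ⧸ p) :=
    a₀.extendScalarsOfSurjective Ideal.Quotient.mk_surjective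
  have ha (x : M) : a (Submodule.Quotient.mk x) = q (i x) := rfl
  have hinj : Function.Injective a := by
    rw [injective_iff_map_eq_zero]
    intro y hy
    obtain ⟨x, rfl⟩ := Submodule.Quotient.mk_surjective _ y
    rw [ha] at hy
    rw [Submodule.Quotient.mk_eq_zero, ← hρi x, pi_eq_sum_univ' (i x), map_sum]
    refine Submodule.sum_mem _ fun j _ ↦ ?_
    rw [map_smul]
    exact Submodule.smul_mem_smul (Ideal.Quotient.eq_zero_iff_mem.1 (congrFun hy j)) trivial
  rw [Matrix.rank, ← LinearMap.finrank_range_of_inj hinj]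
  suffices hrange : LinearMap.range a =
      LinearMap.range (F.map (Ideal.Quotient.mk p)).mulVecLin by rw [hrange]
  apply le_antisymm
  · rintro _ ⟨y, rfl⟩
    obtain ⟨x, rfl⟩ := Submodule.Quotient.mk_surjective _ y
    exact ⟨q (i x), by rw [ha, ← hqF, ← hiρ, hρi]⟩
  · rintro _ ⟨w, rfl⟩
    obtain ⟨x, rfl⟩ : ∃ x, q x = w := by
      choose x hx using fun j ↦ Ideal.Quotient.mk_surjective (w j)
      exact ⟨x, funext hx⟩
    exact ⟨Submodule.Quotient.mk (ρ x), by rw [ha, hiρ, hqF]⟩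

lemma rank_add_rank_sub_mul {K : Type*} [Field K] {E P : Matrix (Fin m) (Fin m) K}
    (hP : P * P = P) (hE : E * E = E) (hPE : P * E = E) :
    E.rank + (P - E * P).rank = P.rank := by
  have hsup : LinearMap.range E.mulVecLin ⊔ LinearMap.range (P - E * P).mulVecLin =
      LinearMap.range P.mulVecLin := by
    apply le_antisymm
    · refine sup_le ?_ ?_
      · rw [← hPE, Matrix.mulVecLin_mul]
        exact LinearMap.range_comp_le_range _ _
      · have : P - E * P = P * (P - E * P) := by
          rw [Matrix.mul_sub, hP, ← Matrix.mul_assoc, hPE]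
        rw [this, Matrix.mulVecLin_mul]
        exact LinearMap.range_comp_le_range _ _
    · rintro _ ⟨x, rfl⟩
      refine Submodule.mem_sup.2 ⟨_, ⟨P.mulVec x, rfl⟩, _, ⟨x, rfl⟩, ?_⟩
      simp
  have hinf : LinearMap.range E.mulVecLin ⊓ LinearMap.range (P - E * P).mulVecLin = ⊥ := by
    rw [eq_bot_iff]
    rintro _ ⟨⟨x, rfl⟩, ⟨y, hy⟩⟩
    have h := congrArg E.mulVec hy
    simp only [Matrix.mulVecLin_apply, Matrix.mulVec_mulVec, hE, Matrix.mul_sub,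
      ← Matrix.mul_assoc, sub_self, Matrix.zero_mulVec] at h
    rw [Submodule.mem_bot, Matrix.mulVecLin_apply, ← h]
  have := Submodule.finrank_sup_add_finrank_inf_eq (LinearMap.range E.mulVecLin)
    (LinearMap.range (P - E * P).mulVecLin)
  rw [hsup, hinf, finrank_bot, add_zero] at this
  exact this.symm

end Idempotent

/-- With `E = A * H` over `R ⧸ (f)`, the cokernel of `A` inside the range of `P` embeds in a free
`R ⧸ (f)`-module as the range of `(1 - E) * P`. -/
lemma exists_embedding_cokernel {R : Type*} [CommRing R] {m n : ℕ} {f : R}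
    {A : Matrix (Fin m) (Fin n) R} {G : Matrix (Fin n) (Fin m) R}
    {P : Matrix (Fin m) (Fin m) R} (hG : A * G = f • P) (hPA : P * A = A) (hPP : P * P = P)
    {H : Matrix (Fin n) (Fin m) (R ⧸ Ideal.span {f})}
    (hH : A.map (Ideal.Quotient.mk (Ideal.span {f})) * H *
      A.map (Ideal.Quotient.mk (Ideal.span {f})) = A.map (Ideal.Quotient.mk (Ideal.span {f})))
    (L : Submodule R (LinearMap.range P.mulVecLin))
    (hL : ∀ y, y ∈ L ↔ (y : Fin m → R) ∈ LinearMap.range A.mulVecLin) :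
    ∃ i : (LinearMap.range P.mulVecLin ⧸ L) →ₗ[R] (Fin m → R ⧸ Ideal.span {f}),
      Function.Injective i ∧
      ∀ w, w ∈ LinearMap.range i ↔ w ∈ LinearMap.range
        (P.map (Ideal.Quotient.mk (Ideal.span {f})) -
          A.map (Ideal.Quotient.mk (Ideal.span {f})) * H *
            P.map (Ideal.Quotient.mk (Ideal.span {f}))).mulVecLin := by
  set c := Ideal.Quotient.mk (Ideal.span {f})
  let F := P.map c - A.map c * H * P.map c
  let q : (Fin m → R) →ₗ[R] (Fin m → R ⧸ Ideal.span {f}) :=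
    (Ideal.Quotient.mkₐ R (Ideal.span {f})).toLinearMap.compLeft (Fin m)
  have hmap {a b : ℕ} (B : Matrix (Fin a) (Fin b) R) (x : Fin b → R) :
      c ∘ (B.mulVec x) = (B.map c).mulVec (c ∘ x) := by
    ext j
    simp [Matrix.mulVec, dotProduct]
  have hsurj {a : ℕ} (w : Fin a → R ⧸ Ideal.span {f}) : ∃ x : Fin a → R, c ∘ x = w := by
    choose x hx using fun j ↦ Ideal.Quotient.mk_surjective (w j)
    exact ⟨x, funext hx⟩
  have hFP : F * P.map c = F := by
    have : P.map c * P.map c = P.map c := by rw [← Matrix.map_mul, hPP]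
    rw [Matrix.sub_mul, Matrix.mul_assoc _ _ (P.map c), this]
  have hFA : F * A.map c = 0 := by
    have : P.map c * A.map c = A.map c := by rw [← Matrix.map_mul, hPA]
    rw [Matrix.sub_mul, Matrix.mul_assoc _ _ (A.map c), this, hH, sub_self]
  let g : LinearMap.range P.mulVecLin →ₗ[R] (Fin m → R ⧸ Ideal.span {f}) :=
    F.mulVecLin.restrictScalars R ∘ₗ q ∘ₗ Submodule.subtype _
  have hg (y) : g y = F.mulVec (c ∘ y) := rfl
  have hker : LinearMap.ker g = L := by
    ext ⟨y, hy⟩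
    rw [LinearMap.mem_ker, hL, hg]
    obtain ⟨z, rfl⟩ := hy
    constructor
    · intro h
      simp only [Matrix.mulVecLin_apply, hmap, Matrix.mulVec_mulVec, hFP] at h
      rw [Matrix.sub_mulVec, sub_eq_zero, Matrix.mul_assoc, ← Matrix.mulVec_mulVec] at h
      obtain ⟨x, hx⟩ := hsurj ((H * P.map c).mulVec (c ∘ z))
      rw [← hx, ← hmap, ← hmap] at h
      have hdvd (j) : ∃ t, P.mulVec z j - A.mulVec x j = f * t :=
        Ideal.mem_span_singleton.1 (Ideal.Quotient.eq.1 (congrFun h j))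
      choose t ht using hdvd
      have hPz : P.mulVec z = A.mulVec x + f • t := by
        ext j
        rw [Pi.add_apply, Pi.smul_apply, smul_eq_mul, ← ht]
        ring
      refine ⟨x + G.mulVec t, ?_⟩
      change A.mulVec (x + G.mulVec t) = P.mulVec z
      rw [← hPP, ← Matrix.mulVec_mulVec, hPz, Matrix.mulVec_add,
        Matrix.mulVec_add, Matrix.mulVec_mulVec, Matrix.mulVec_mulVec, hPA, hG,
        Matrix.mulVec_smul, Matrix.smul_mulVec]
    · rintro ⟨x, hx⟩
      change F.mulVec (c ∘ P.mulVecLin z) = 0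
      change A.mulVecLin x = P.mulVecLin z at hx
      rw [← hx, Matrix.mulVecLin_apply, hmap, Matrix.mulVec_mulVec, hFA, Matrix.zero_mulVec]
  refine ⟨L.liftQ g hker.ge, ?_, fun w ↦ ?_⟩
  · rw [← LinearMap.ker_eq_bot]
    exact Submodule.ker_liftQ_eq_bot _ _ _ hker.le
  · rw [Submodule.range_liftQ]
    constructor
    · rintro ⟨y, rfl⟩
      exact ⟨c ∘ y, rfl⟩
    · rintro ⟨w, rfl⟩
      obtain ⟨x, rfl⟩ := hsurj w
      refine ⟨⟨P.mulVec x, x, rfl⟩, ?_⟩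
      rw [hg, hmap, Matrix.mulVec_mulVec, hFP]
      rfl

/-- If `E` and `P` are idempotents of ranks `k` and `k + 1` with `P * E = E`, then a module embedded
as the range of `(1 - E) * P` is a line bundle. -/
lemma lineBundle_of_embedding {S : Type*} [CommRing S] {m k : ℕ} {C : Type*} [AddCommGroup C]
    [Module S C] {E P : Matrix (Fin m) (Fin m) S} (hP : P * P = P) (hE : E * E = E)
    (hPE : P * E = E)
    (hPk : ∀ q : Ideal S, q.IsMaximal → (P.map (Ideal.Quotient.mk q)).rank = k + 1)
    (hEk : ∀ q : Ideal S, q.IsMaximal → (E.map (Ideal.Quotient.mk q)).rank = k)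
    (i : C →ₗ[S] (Fin m → S)) (hi : Function.Injective i)
    (hr : LinearMap.range i = LinearMap.range (P - E * P).mulVecLin) :
    Module.Finite S C ∧ Module.Projective S C ∧ ∀ q : Ideal S, q.IsMaximal →
      Module.finrank (S ⧸ q) (C ⧸ (q • ⊤ : Submodule S C)) = 1 := by
  have hF : (P - E * P) * (P - E * P) = P - E * P := by
    have h1 : P * (E * P) = E * P := by rw [← Matrix.mul_assoc, hPE]
    have h2 : E * P * P = E * P := by rw [Matrix.mul_assoc, hP]
    have h3 : E * P * (E * P) = E * P := by rw [Matrix.mul_assoc, h1, ← Matrix.mul_assoc, hE]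
    rw [Matrix.mul_sub, Matrix.sub_mul, Matrix.sub_mul, hP, h1, h2, h3, sub_self, sub_zero]
  obtain ⟨ρ, h1, h2⟩ := exists_retraction hF i hi hr
  refine ⟨.of_surjective ρ fun x ↦ ⟨i x, LinearMap.congr_fun h1 x⟩, .of_split i ρ h1,
    fun q hq ↦ ?_⟩
  let := Ideal.Quotient.field q
  have h := rank_add_rank_sub_mul (E := E.map (Ideal.Quotient.mk q))
    (P := P.map (Ideal.Quotient.mk q)) (by rw [← Matrix.map_mul, hP])
    (by rw [← Matrix.map_mul, hE]) (by rw [← Matrix.map_mul, hPE])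
  rw [finrank_fiber h1 h2, Matrix.map_sub _ (map_sub _), Matrix.map_mul]
  have h3 := hPk q hq
  have h4 := hEk q hq
  omega

lemma fiberMap_injective_of_retraction {R : Type*} [CommRing R] {M N : Type*} [AddCommGroup M]
    [Module R M] [AddCommGroup N] [Module R N] {i : M →ₗ[R] N} {ρ : N →ₗ[R] M}
    (h : ρ ∘ₗ i = LinearMap.id) (p : Ideal R) : Function.Injective (fiberMap i p) := by
  refine Function.LeftInverse.injective (g := fiberMap ρ p) fun x ↦ ?_
  obtain ⟨x, rfl⟩ := Submodule.Quotient.mk_surjective _ x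
  exact congrArg Submodule.Quotient.mk (LinearMap.congr_fun h x)

/-- **Canonical factorization** (affine form of Proposition 2.8): if `A` is an `m × n`
matrix of rank `r` over `R` whose `(r+1) × (r+1)` minors vanish, whose `r × r` minors
generate the principal ideal of a non-zerodivisor `f`, and whose `(r-1) × (r-1)` minors
generate the unit ideal, then the map `A : Rⁿ → Rᵐ` admits a canonical factorization
`Rⁿ ↠ M₁ → N₁ ↪ Rᵐ` where `M₁, N₁` are projective of rank `r`, the middle map is
injective, and its cokernel is a line bundle on the Cartier divisor `{f = 0}`. -/
theorem canonicalFactorization_exists {R : Type u} [CommRing R]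
    (f : R) (hf : f ∈ nonZeroDivisors R)
    {m n r : ℕ} (hr : 1 ≤ r) (A : Matrix (Fin m) (Fin n) R)
    (h1 : ∀ (g₁ : Fin (r + 1) → Fin m) (g₂ : Fin (r + 1) → Fin n),
      (A.submatrix g₁ g₂).det = 0)
    (h2 : minorsIdeal A r = Ideal.span {f})
    (h3 : minorsIdeal A (r - 1) = ⊤) :
    Nonempty (CanonicalFactorization f r A) := by
  obtain ⟨k, rfl⟩ : ∃ k, r = k + 1 := ⟨r - 1, by omega⟩
  have h1' : minorsIdeal A (k + 1 + 1) = ⊥ :=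
    le_bot_iff.1 ((minorsIdeal_le_iff A).2 fun I J ↦ by rw [h1]; exact zero_mem _)
  obtain ⟨G, P, Q, hP, hQ, hPA, hAQ, hPP, hQQ⟩ := exists_idempotents hf A h1' h2
  obtain ⟨ρP, hρP, hρP'⟩ := exists_retraction hPP (LinearMap.range P.mulVecLin).subtype
    Subtype.val_injective (Submodule.range_subtype _)
  obtain ⟨ρQ, hρQ, hρQ'⟩ := exists_retraction hQQ (LinearMap.range Q.mulVecLin).subtype
    Subtype.val_injective (Submodule.range_subtype _)
  let c := Ideal.Quotient.mk (Ideal.span {f})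
  have hone : (1 : R ⧸ Ideal.span {f}) ∈ nonZeroDivisors (R ⧸ Ideal.span {f}) := one_mem _
  have hA1 : minorsIdeal (A.map c) (k + 1) = ⊥ := by
    rw [minorsIdeal_map, h2, Ideal.map_quotient_self]
  have hA2 : minorsIdeal (A.map c) k = Ideal.span {1} := by
    rw [minorsIdeal_map, ← Nat.add_sub_cancel k 1, h3, Ideal.map_top, Ideal.span_singleton_one]
  obtain ⟨H, E, -, hE, -, hEA, -, hEE, -⟩ := exists_idempotents hone (A.map c) hA1 hA2
  have hE' : A.map c * H = E := by rw [hE, one_smul]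
  have hPE : P.map c * E = E := by
    rw [← hE', ← Matrix.mul_assoc, ← Matrix.map_mul, hPA]
  have hmem (x : Fin n → R) : A.mulVec x ∈ LinearMap.range P.mulVecLin :=
    ⟨A.mulVec x, by rw [Matrix.mulVecLin_apply, Matrix.mulVec_mulVec, hPA]⟩
  have hAρ (x : Fin n → R) : A.mulVec (ρQ x) = A.mulVec x := by
    rw [show (ρQ x : Fin n → R) = Q.mulVec x from LinearMap.congr_fun hρQ' x,
      Matrix.mulVec_mulVec, hAQ]
  let φ₁ : LinearMap.range Q.mulVecLin →ₗ[R] LinearMap.range P.mulVecLin :=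
    (A.mulVecLin ∘ₗ Submodule.subtype _).codRestrict _ fun x ↦ hmem x
  have hφ₁ (x) : (φ₁ x : Fin m → R) = A.mulVec x := rfl
  have hL (y) : y ∈ LinearMap.range φ₁ ↔ (y : Fin m → R) ∈ LinearMap.range A.mulVecLin := by
    constructor
    · rintro ⟨x, rfl⟩
      exact ⟨x, rfl⟩
    · rintro ⟨x, hx⟩
      exact ⟨ρQ x, Subtype.ext (by rw [hφ₁, hAρ, ← hx, Matrix.mulVecLin_apply])⟩
  have htors : Module.IsTorsionBy R
      (LinearMap.range P.mulVecLin ⧸ LinearMap.range φ₁) f := by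
    rintro ⟨y, z, rfl⟩
    refine (Submodule.Quotient.mk_eq_zero _).2 ((hL _).2 ⟨G.mulVec z, ?_⟩)
    change A.mulVec (G.mulVec z) = f • P.mulVec z
    rw [Matrix.mulVec_mulVec, hP, Matrix.smul_mulVec]
  refine ⟨{
    M₁ := LinearMap.range Q.mulVecLin
    N₁ := LinearMap.range P.mulVecLin
    finM := .of_surjective ρQ fun x ↦ ⟨x, LinearMap.congr_fun hρQ x⟩
    projM := .of_split _ ρQ hρQ
    finN := .of_surjective ρP fun x ↦ ⟨x, LinearMap.congr_fun hρP x⟩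
    projN := .of_split _ ρP hρP
    fiberDimM := fun p hp ↦ ?_
    fiberDimN := fun p hp ↦ ?_
    π := ρQ
    hπ := fun x ↦ ⟨x, LinearMap.congr_fun hρQ x⟩
    ι := Submodule.subtype _
    hι := fun p _ ↦ fiberMap_injective_of_retraction hρP p
    φ₁ := φ₁
    hφ₁ := ?_
    factorization := LinearMap.ext fun x ↦ (hAρ x).symm
    cokerTorsion := htors
    cokerLineBundle := ?_ }⟩
  · let := Ideal.Quotient.field p
    rw [finrank_fiber hρQ hρQ', ← Matrix.rank_transpose, ← Matrix.transpose_map]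
    refine rank_map_saturation hf (A := A.transpose) (G := G.transpose) ?_ ?_ ?_ ?_ _
    · rw [minorsIdeal_transpose, h1']
    · rw [minorsIdeal_transpose, h2]
    · rw [← Matrix.transpose_mul, hQ, Matrix.transpose_smul]
    · rw [← Matrix.transpose_mul, hAQ]
  · let := Ideal.Quotient.field p
    rw [finrank_fiber hρP hρP']
    exact rank_map_saturation hf h1' h2 hP hPA _
  · rw [injective_iff_map_eq_zero]
    rintro ⟨_, x, rfl⟩ hx
    have hx' : A.mulVec (Q.mulVec x) = 0 := congrArg Subtype.val hx
    have h0 : f • Q.mulVec x = 0 := by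
      rw [← Matrix.smul_mulVec, ← hQ, ← Matrix.mulVec_mulVec, ← hAQ, ← Matrix.mulVec_mulVec, hx',
        Matrix.mulVec_zero]
    refine Subtype.ext (funext fun j ↦ mem_nonZeroDivisors_iff_right.1 hf _ ?_)
    rw [mul_comm]
    exact congrFun h0 j
  · obtain ⟨i, hi, hr⟩ := exists_embedding_cokernel hP hPA hPP (H := H)
      (by change A.map c * H * A.map c = A.map c; rw [hE', hEA]) (LinearMap.range φ₁) hL
    let : Module (R ⧸ Ideal.span {f}) (LinearMap.range P.mulVecLin ⧸ LinearMap.range φ₁) :=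
      htors.module
    have : IsScalarTower R (R ⧸ Ideal.span {f})
        (LinearMap.range P.mulVecLin ⧸ LinearMap.range φ₁) :=
      Module.IsTorsionBySet.isScalarTower _
    refine lineBundle_of_embedding (k := k) (E := E) (P := P.map c)
      (by rw [← Matrix.map_mul, hPP]) hEE hPE (fun q hq ↦ ?_) (fun q hq ↦ ?_)
      (i.extendScalarsOfSurjective Ideal.Quotient.mk_surjective) hi ?_
    · let := Ideal.Quotient.field q
      have := rank_map_saturation hf h1' h2 hP hPA ((Ideal.Quotient.mk q).comp c)
      rwa [RingHom.coe_comp, ← Matrix.map_map] at this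
    · let := Ideal.Quotient.field q
      exact rank_map_saturation hone hA1 hA2 hE hEA _
    · ext w
      rw [← hE']
      exact hr w
end

section
/- Let R be a commutative local ring, let f ∈ R be a non-zerodivisor, let m, n, r be natural numbers with 1 ≤ r ≤ m and r ≤ n, and let A : Matrix (Fin m) (Fin n) R. Assume: (i) every (r+1)×(r+1) minor of A is zero; (ii) the ideal of r×r minors of A equals Ideal.span {f}; (iii) some (r-1)×(r-1) minor of A is a unit of R. Then there exist an invertible matrix P : Matrix (Fin m) (Fin m) R, an invertible matrix Q : Matrix (Fin n) (Fin n) R, and an element g ∈ R with Ideal.span {g} equal to the ideal of r×r minors of A, such that the matrix P * A * Q has entries: 1 at every diagonal position (i, i) with (i : ℕ) < r - 1, the element g at the diagonal position with index r - 1, and 0 at all other positions. -/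
namespace Matrix

variable {R : Type*} [CommRing R]

/-- Two matrices, possibly indexed by different types, are equivalent if one is obtained from the
other by multiplying on both sides by invertible matrices. -/
def IsEquivalent {m n m' n' : Type*} [Fintype m] [Fintype n] [Fintype m'] [Fintype n']
    [DecidableEq m] [DecidableEq n] [DecidableEq m'] [DecidableEq n']
    (M : Matrix m n R) (N : Matrix m' n' R) : Prop :=
  ∃ (P : Matrix m' m R) (P' : Matrix m m' R) (Q : Matrix n n' R) (Q' : Matrix n' n R),
    P * P' = 1 ∧ P' * P = 1 ∧ Q * Q' = 1 ∧ Q' * Q = 1 ∧ P * M * Q = N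

section

variable {m n m' n' m'' n'' p : Type*} [Fintype m] [Fintype n] [Fintype m'] [Fintype n']
  [Fintype m''] [Fintype n''] [Fintype p]
  [DecidableEq m] [DecidableEq n] [DecidableEq m'] [DecidableEq n'] [DecidableEq m'']
  [DecidableEq n''] [DecidableEq p]

theorem IsEquivalent.trans {M : Matrix m n R} {N : Matrix m' n' R} {L : Matrix m'' n'' R}
    (h : M.IsEquivalent N) (h' : N.IsEquivalent L) : M.IsEquivalent L := by
  obtain ⟨P, P', Q, Q', hP, hP', hQ, hQ', rfl⟩ := h
  obtain ⟨U, U', V, V', hU, hU', hV, hV', rfl⟩ := h'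
  refine ⟨U * P, P' * U', Q * V, V' * Q', ?_, ?_, ?_, ?_, by simp only [Matrix.mul_assoc]⟩
  · rw [Matrix.mul_assoc, ← Matrix.mul_assoc P, hP, Matrix.one_mul, hU]
  · rw [Matrix.mul_assoc, ← Matrix.mul_assoc U', hU', Matrix.one_mul, hP']
  · rw [Matrix.mul_assoc, ← Matrix.mul_assoc V, hV, Matrix.one_mul, hQ]
  · rw [Matrix.mul_assoc, ← Matrix.mul_assoc Q', hQ', Matrix.one_mul, hV']

theorem isEquivalent_submatrix (M : Matrix m n R) (e₁ : m' ≃ m) (e₂ : n' ≃ n) :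
    M.IsEquivalent (M.submatrix e₁ e₂) := by
  refine ⟨(1 : Matrix m m R).submatrix e₁ id, (1 : Matrix m m R).submatrix id e₁,
    (1 : Matrix n n R).submatrix id e₂, (1 : Matrix n n R).submatrix e₂ id, ?_, ?_, ?_, ?_, ?_⟩
  · rw [← submatrix_mul _ _ _ _ _ Function.bijective_id, Matrix.one_mul, submatrix_one_equiv]
  · rw [submatrix_mul_equiv, Matrix.one_mul, submatrix_id_id]
  · rw [submatrix_mul_equiv, Matrix.one_mul, submatrix_id_id]
  · rw [← submatrix_mul _ _ _ _ _ Function.bijective_id, Matrix.one_mul, submatrix_one_equiv]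
  · ext i j
    simp [Matrix.mul_apply, one_apply]

theorem IsEquivalent.of_submatrix {M : Matrix m n R} {e₁ : m' ≃ m} {e₂ : n' ≃ n}
    {N : Matrix m'' n'' R} (h : (M.submatrix e₁ e₂).IsEquivalent N) : M.IsEquivalent N :=
  (isEquivalent_submatrix M e₁ e₂).trans h

theorem IsEquivalent.smul {M : Matrix m n R} {N : Matrix m' n' R} (h : M.IsEquivalent N) (c : R) :
    (c • M).IsEquivalent (c • N) := by
  obtain ⟨P, P', Q, Q', hP, hP', hQ, hQ', rfl⟩ := h
  exact ⟨P, P', Q, Q', hP, hP', hQ, hQ', by simp⟩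

theorem IsEquivalent.fromBlocks_one {M : Matrix m n R} {N : Matrix m' n' R}
    (h : M.IsEquivalent N) :
    (fromBlocks (1 : Matrix p p R) 0 0 M).IsEquivalent (fromBlocks (1 : Matrix p p R) 0 0 N) := by
  obtain ⟨P, P', Q, Q', hP, hP', hQ, hQ', rfl⟩ := h
  exact ⟨fromBlocks 1 0 0 P, fromBlocks 1 0 0 P', fromBlocks 1 0 0 Q, fromBlocks 1 0 0 Q',
    by simp [fromBlocks_multiply, hP], by simp [fromBlocks_multiply, hP'],
    by simp [fromBlocks_multiply, hQ], by simp [fromBlocks_multiply, hQ'],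
    by simp [fromBlocks_multiply]⟩

theorem isEquivalent_fromBlocks_schur {B : Matrix p p R} (hB : IsUnit B.det) (C : Matrix p n R)
    (D : Matrix m p R) (E : Matrix m n R) :
    (fromBlocks B C D E).IsEquivalent
      (fromBlocks (1 : Matrix p p R) 0 0 (E - D * B⁻¹ * C)) := by
  refine ⟨fromBlocks B⁻¹ 0 (-(D * B⁻¹)) 1, fromBlocks B 0 D 1, fromBlocks 1 (-(B⁻¹ * C)) 0 1,
    fromBlocks 1 (B⁻¹ * C) 0 1, ?_, ?_, ?_, ?_, ?_⟩
  · simp [fromBlocks_multiply, Matrix.mul_assoc, nonsing_inv_mul B hB]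
  · simp [fromBlocks_multiply, mul_nonsing_inv B hB]
  · simp [fromBlocks_multiply]
  · simp [fromBlocks_multiply]
  · simp [fromBlocks_multiply, Matrix.mul_assoc, nonsing_inv_mul B hB, sub_eq_neg_add]

end

theorem det_submatrix_fromBlocks {m n p q : Type*} [Fintype p] [DecidableEq p] [Fintype q]
    [DecidableEq q] {B : Matrix p p R} (hB : IsUnit B.det) (C : Matrix p n R)
    (D : Matrix m p R) (E : Matrix m n R) (i : q → m) (j : q → n) :
    ((fromBlocks B C D E).submatrix (Sum.map id i) (Sum.map id j)).det =
      B.det * ((E - D * B⁻¹ * C).submatrix i j).det := by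
  have hM : (fromBlocks B C D E).submatrix (Sum.map id i) (Sum.map id j) =
      fromBlocks B (C.submatrix id j) (D.submatrix i id) (E.submatrix i j) := by
    ext (a | a) (b | b) <;> rfl
  let := invertibleOfIsUnitDet B hB
  rw [hM, det_fromBlocks₁₁, invOf_eq_nonsing_inv]
  congr 2

theorem det_mul_eq_zero_of_card_lt {m p : Type*} [Fintype m] [DecidableEq m] [Fintype p]
    (h : Fintype.card p < Fintype.card m) (X : Matrix m p R) (Y : Matrix p m R) :
    (X * Y).det = 0 := by
  have hpos : 0 < Fintype.card m - Fintype.card p := Nat.sub_pos_of_lt h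
  let e : p ⊕ Fin (Fintype.card m - Fintype.card p) ≃ m := Fintype.equivOfCardEq (by simp; omega)
  have : X * Y = (fromCols X 0).submatrix id e.symm * (fromRows Y 0).submatrix e.symm id := by
    simp [submatrix_mul_equiv, fromCols_mul_fromRows]
  rw [this, det_mul, det_eq_zero_of_column_eq_zero (e (Sum.inr ⟨0, hpos⟩)) (by simp), zero_mul]

theorem submatrix_injective_of_isUnit_det [Nontrivial R] {m n p : Type*} [Fintype p]
    [DecidableEq p] {M : Matrix m n R} {g₁ : p → m} {g₂ : p → n}
    (h : IsUnit (M.submatrix g₁ g₂).det) : Function.Injective g₁ ∧ Function.Injective g₂ := by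
  constructor <;> intro a b hab <;> by_contra hne
  · exact h.ne_zero (det_zero_of_row_eq hne (by ext; simp [hab]))
  · exact h.ne_zero (det_zero_of_column_eq hne (by simp [hab]))

/-- Modulo an ideal containing the Schur complement of an invertible block `B`, the matrix factors
through `B`, so that its minors of larger size vanish. -/
theorem det_submatrix_mem_of_schur_mem {m n p q : Type*} [Fintype p] [DecidableEq p] [Fintype q]
    [DecidableEq q] {B : Matrix p p R} (hB : IsUnit B.det) (C : Matrix p n R)
    (D : Matrix m p R) (E : Matrix m n R) (J : Ideal R)
    (hJ : ∀ i j, (E - D * B⁻¹ * C) i j ∈ J) (h : Fintype.card p < Fintype.card q)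
    (i : q → p ⊕ m) (j : q → p ⊕ n) : ((fromBlocks B C D E).submatrix i j).det ∈ J := by
  let Z := fromBlocks B C D (D * B⁻¹ * C)
  have hZ : Z = fromRows B D * (B⁻¹ * fromCols B C) := by
    rw [mul_fromCols, fromRows_mul_fromCols, nonsing_inv_mul B hB, ← Matrix.mul_assoc B,
      mul_nonsing_inv B hB]
    simp [Z, Matrix.mul_assoc]
  have hdet : (Z.submatrix i j).det = 0 := by
    rw [hZ, submatrix_mul _ _ _ id _ Function.bijective_id, det_mul_eq_zero_of_card_lt h]
  have hmap : ((fromBlocks B C D E).submatrix i j).map (Ideal.Quotient.mk J) =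
      (Z.submatrix i j).map (Ideal.Quotient.mk J) := by
    ext a b
    simp only [map_apply, submatrix_apply, Z]
    rcases i a with a' | a' <;> rcases j b with b' | b' <;> simp only [fromBlocks_apply₁₁,
      fromBlocks_apply₁₂, fromBlocks_apply₂₁, fromBlocks_apply₂₂]
    exact Ideal.Quotient.eq.2 (hJ a' b')
  rw [← Ideal.Quotient.eq_zero_iff_mem, RingHom.map_det, RingHom.mapMatrix_apply, hmap,
    ← RingHom.mapMatrix_apply, ← RingHom.map_det, hdet, map_zero]

end Matrix

theorem Function.Injective.exists_sum_fin_equiv {k a : ℕ} {g : Fin k → Fin (k + a)}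
    (hg : Function.Injective g) : ∃ e : Fin k ⊕ Fin a ≃ Fin (k + a), ∀ i, e (Sum.inl i) = g i := by
  classical
  have hc : Fintype.card {x // ¬ x ∈ Set.range g} = a := by
    rw [Fintype.card_subtype_compl, Fintype.card_fin, Set.card_range_of_injective hg,
      Fintype.card_fin, Nat.add_sub_cancel_left]
  refine ⟨(Equiv.sumCongr (Equiv.ofInjective g hg) (Fintype.equivFinOfCardEq hc).symm).trans
    (Equiv.sumCompl (· ∈ Set.range g)), fun i ↦ by simp⟩

/-- If the entries of a matrix over a local ring generate the ideal of a non-zerodivisor, the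
matrix is a multiple of one with a unit entry. -/
theorem Matrix.exists_eq_smul_isUnit {R : Type*} [CommRing R] [IsLocalRing R] {m n : Type*}
    {f : R} (hf : f ∈ nonZeroDivisors R) (S : Matrix m n R)
    (hS : ∀ i j, S i j ∈ Ideal.span {f})
    (hfS : f ∈ Ideal.span (Set.range fun x : m × n ↦ S x.1 x.2)) :
    ∃ T : Matrix m n R, S = f • T ∧ ∃ i j, IsUnit (T i j) := by
  choose T hT using fun i j ↦ Ideal.mem_span_singleton.1 (hS i j)
  refine ⟨of T, by ext i j; simp [hT], ?_⟩
  by_contra! hc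
  obtain ⟨c, hc'⟩ : ∃ c ∈ IsLocalRing.maximalIdeal R, f = f * c := by
    have hle : Ideal.span (Set.range fun x : m × n ↦ S x.1 x.2) ≤
        Ideal.span {f} * IsLocalRing.maximalIdeal R := by
      rw [Ideal.span_le]
      rintro _ ⟨x, rfl⟩
      exact Ideal.mem_span_singleton_mul.2 ⟨T x.1 x.2, hc _ _, (hT _ _).symm⟩
    obtain ⟨c, hc, h⟩ := Ideal.mem_span_singleton_mul.1 (hle hfS)
    exact ⟨c, hc, h.symm⟩
  have h0 : (1 - c) * f = 0 := by linear_combination hc'.2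
  have : 1 - c = 0 := (mem_nonZeroDivisors_iff_right.1 hf) _ h0
  rw [← sub_eq_zero.1 this] at hc'
  exact (IsLocalRing.maximalIdeal.isMaximal R).ne_top ((Ideal.eq_top_iff_one _).2 hc'.1)

/-- A matrix with a unit entry and vanishing `2 × 2` minors is equivalent to a matrix unit. -/
theorem Matrix.isEquivalent_of_isUnit_apply {R : Type*} [CommRing R] {a b : ℕ}
    (T : Matrix (Fin (1 + a)) (Fin (1 + b)) R) {i₀ : Fin (1 + a)} {j₀ : Fin (1 + b)}
    (hu : IsUnit (T i₀ j₀))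
    (hT : ∀ (i : Fin 1 ⊕ Fin 1 → Fin (1 + a)) (j : Fin 1 ⊕ Fin 1 → Fin (1 + b)),
      (T.submatrix i j).det = 0) :
    T.IsEquivalent (fromBlocks 1 0 0 0 : Matrix (Fin 1 ⊕ Fin a) (Fin 1 ⊕ Fin b) R) := by
  obtain ⟨e₁, he₁⟩ := (Function.injective_of_subsingleton fun _ : Fin 1 ↦ i₀).exists_sum_fin_equiv
  obtain ⟨e₂, he₂⟩ := (Function.injective_of_subsingleton fun _ : Fin 1 ↦ j₀).exists_sum_fin_equiv
  apply IsEquivalent.of_submatrix (e₁ := e₁) (e₂ := e₂)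
  set N := T.submatrix e₁ e₂ with hN
  have hB : IsUnit N.toBlocks₁₁.det := by
    simpa [hN, toBlocks₁₁, he₁, he₂] using hu
  have hS : N.toBlocks₂₂ - N.toBlocks₂₁ * N.toBlocks₁₁⁻¹ * N.toBlocks₁₂ = 0 := by
    ext i j
    have h := det_submatrix_fromBlocks hB N.toBlocks₁₂ N.toBlocks₂₁ N.toBlocks₂₂
      (fun _ : Fin 1 ↦ i) (fun _ ↦ j)
    rw [fromBlocks_toBlocks, hN, submatrix_submatrix, hT, ← hN, det_fin_one (submatrix _ _ _)] at h
    exact hB.mul_right_eq_zero.1 h.symm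
  rw [← fromBlocks_toBlocks N, ← hS]
  exact isEquivalent_fromBlocks_schur hB _ _ _

theorem Matrix.isEquivalent_fromBlocks_smul {R : Type*} [CommRing R] [IsLocalRing R]
    {f : R} (hf : f ∈ nonZeroDivisors R) {k a b : ℕ}
    (A : Matrix (Fin (k + (1 + a))) (Fin (k + (1 + b))) R)
    (h1 : ∀ (g₁ : Fin (k + 1 + 1) → Fin (k + (1 + a))) (g₂ : Fin (k + 1 + 1) → Fin (k + (1 + b))),
      (A.submatrix g₁ g₂).det = 0)
    (h2 : minorsIdeal A (k + 1) = Ideal.span {f})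
    {g₁ : Fin k → Fin (k + (1 + a))} {g₂ : Fin k → Fin (k + (1 + b))}
    (h3 : IsUnit (A.submatrix g₁ g₂).det) :
    A.IsEquivalent (fromBlocks 1 0 0 (f • fromBlocks 1 0 0 0) :
      Matrix (Fin k ⊕ (Fin 1 ⊕ Fin a)) (Fin k ⊕ (Fin 1 ⊕ Fin b)) R) := by
  obtain ⟨e₁, he₁⟩ := (submatrix_injective_of_isUnit_det h3).1.exists_sum_fin_equiv
  obtain ⟨e₂, he₂⟩ := (submatrix_injective_of_isUnit_det h3).2.exists_sum_fin_equiv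
  apply IsEquivalent.of_submatrix (e₁ := e₁) (e₂ := e₂)
  set N := A.submatrix e₁ e₂ with hN
  have hB : IsUnit N.toBlocks₁₁.det := by
    convert h3
    ext i j
    simp [hN, toBlocks₁₁, he₁, he₂]
  set S := N.toBlocks₂₂ - N.toBlocks₂₁ * N.toBlocks₁₁⁻¹ * N.toBlocks₁₂ with hS
  have hmem : ∀ i j, S i j ∈ Ideal.span {f} := by
    intro i j
    have h := det_submatrix_fromBlocks hB N.toBlocks₁₂ N.toBlocks₂₁ N.toBlocks₂₂
      (fun _ : Fin 1 ↦ i) (fun _ ↦ j)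
    rw [fromBlocks_toBlocks, ← hS, det_fin_one (S.submatrix _ _),
      ← det_submatrix_equiv_self finSumFinEquiv.symm,
      hN, submatrix_submatrix, submatrix_submatrix, ← hN] at h
    rw [← h2, ← (minorsIdeal A (k + 1)).unit_mul_mem_iff_mem hB]
    exact Ideal.subset_span ⟨_, _, h.symm⟩
  have hfS : f ∈ Ideal.span (Set.range fun x : Fin (1 + a) × Fin (1 + b) ↦ S x.1 x.2) := by
    have hf' : f ∈ minorsIdeal A (k + 1) := h2 ▸ Ideal.mem_span_singleton_self f
    refine (Ideal.span_le.2 ?_ : minorsIdeal A (k + 1) ≤ _) hf'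
    rintro _ ⟨i, j, rfl⟩
    have h := det_submatrix_mem_of_schur_mem hB N.toBlocks₁₂ N.toBlocks₂₁ N.toBlocks₂₂
      (Ideal.span (Set.range fun x : Fin (1 + a) × Fin (1 + b) ↦ S x.1 x.2))
      (fun i j ↦ Ideal.subset_span ⟨(i, j), rfl⟩) (by simp) (e₁.symm ∘ i) (e₂.symm ∘ j)
    rw [fromBlocks_toBlocks, hN, submatrix_submatrix] at h
    simpa [← Function.comp_assoc] using h
  obtain ⟨T, hT, i₀, j₀, hu⟩ := exists_eq_smul_isUnit hf S hmem hfS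
  have hT2 : ∀ (i : Fin 1 ⊕ Fin 1 → Fin (1 + a)) (j : Fin 1 ⊕ Fin 1 → Fin (1 + b)),
      (T.submatrix i j).det = 0 := by
    intro i j
    have h := det_submatrix_fromBlocks hB N.toBlocks₁₂ N.toBlocks₂₁ N.toBlocks₂₂ i j
    rw [fromBlocks_toBlocks, ← hS, ← det_submatrix_equiv_self
      (((Equiv.sumAssoc (Fin k) (Fin 1) (Fin 1)).symm.trans
        (Equiv.sumCongr finSumFinEquiv (Equiv.refl _))).trans finSumFinEquiv).symm,
      hN, submatrix_submatrix, submatrix_submatrix, h1, ← hN, hT,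
      show (f • T).submatrix i j = f • T.submatrix i j from rfl, det_smul] at h
    have h' := hB.mul_right_eq_zero.1 h.symm
    rw [mul_comm] at h'
    exact (mem_nonZeroDivisors_iff_right.1 (pow_mem hf _)) _ h'
  have h := isEquivalent_fromBlocks_schur hB N.toBlocks₁₂ N.toBlocks₂₁ N.toBlocks₂₂
  rw [fromBlocks_toBlocks, ← hS, hT] at h
  exact h.trans ((isEquivalent_of_isUnit_apply T hu hT2).smul f).fromBlocks_one


/-- **Local normal form** (from the proof of Proposition 2.8): over a local ring, a
matrix of rank `r` whose `(r-1) × (r-1)` minors contain a unit and whose `r × r` minors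
generate the principal ideal of a non-zerodivisor `f` is equivalent, under invertible row
and column operations, to the diagonal matrix `diag(1, …, 1, g)` (with `r - 1` ones and
`g` a generator of the ideal of `r × r` minors), padded by zeros. -/
theorem local_normal_form {R : Type*} [CommRing R] [IsLocalRing R]
    (f : R) (hf : f ∈ nonZeroDivisors R)
    {m n r : ℕ} (hr1 : 1 ≤ r) (hrm : r ≤ m) (hrn : r ≤ n)
    (A : Matrix (Fin m) (Fin n) R)
    (h1 : ∀ (g₁ : Fin (r + 1) → Fin m) (g₂ : Fin (r + 1) → Fin n),
      (A.submatrix g₁ g₂).det = 0)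
    (h2 : minorsIdeal A r = Ideal.span {f})
    (h3 : ∃ (g₁ : Fin (r - 1) → Fin m) (g₂ : Fin (r - 1) → Fin n),
      IsUnit (A.submatrix g₁ g₂).det) :
    ∃ (P : Matrix (Fin m) (Fin m) R) (Q : Matrix (Fin n) (Fin n) R) (g : R),
      IsUnit P.det ∧ IsUnit Q.det ∧ Ideal.span {g} = minorsIdeal A r ∧
      ∀ (i : Fin m) (j : Fin n),
        (P * A * Q) i j =
          if (i : ℕ) = (j : ℕ) ∧ (i : ℕ) < r - 1 then 1
          else if (i : ℕ) = (j : ℕ) ∧ (i : ℕ) = r - 1 then g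
          else 0 := by
  obtain ⟨k, rfl⟩ := Nat.exists_eq_add_of_le' hr1
  obtain ⟨a, rfl⟩ : ∃ a, m = k + (1 + a) := ⟨m - (k + 1), by omega⟩
  obtain ⟨b, rfl⟩ : ∃ b, n = k + (1 + b) := ⟨n - (k + 1), by omega⟩
  obtain ⟨g₁, g₂, h3⟩ := h3
  let e (c : ℕ) : Fin k ⊕ (Fin 1 ⊕ Fin c) ≃ Fin (k + (1 + c)) :=
    (Equiv.sumCongr (Equiv.refl _) finSumFinEquiv).trans finSumFinEquiv
  obtain ⟨P, P', Q, Q', hP, -, hQ, -, h⟩ := (Matrix.isEquivalent_fromBlocks_smul hf A h1 h2 h3).trans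
    (Matrix.isEquivalent_submatrix _ (e a).symm (e b).symm)
  refine ⟨P, Q, f, Matrix.isUnit_det_of_right_inverse hP, Matrix.isUnit_det_of_right_inverse hQ,
    h2.symm, fun i j ↦ ?_⟩
  rw [h]
  obtain ⟨i, rfl⟩ := (e a).surjective i
  obtain ⟨j, rfl⟩ := (e b).surjective j
  rw [Matrix.submatrix_apply, Equiv.symm_apply_apply, Equiv.symm_apply_apply]
  rcases i with i | i | i <;> rcases j with j | j | j <;>
    simp [e, Matrix.one_apply, Fin.ext_iff] <;> grind
end

section
/- Let R be a commutative local ring, let t ∈ R be a non-zerodivisor which is not a unit, let r be a natural number, and let q : Matrix (Fin (r+1)) (Fin (r+1)) R be a symmetric matrix (q.IsSymm) such that t divides q 0 j for every j, and such that Ideal.span {q.det} = Ideal.span {t}. Then: (a) the determinant of the r×r submatrix q.submatrix Fin.succ Fin.succ (obtained by deleting row 0 and column 0) is a unit of R; and (b) there exists c ∈ R with q 0 0 = t * c, and every such c is a unit of R. -/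
/-- If column `0` of `A` below the diagonal vanishes under a ring homomorphism `f`, so does
every minor obtained by deleting row `0` and a column other than `0`. -/
theorem map_det_submatrix_succAbove_eq_zero {R S : Type*} [CommRing R] [CommRing S]
    (f : R →+* S) {r : ℕ} (A : Matrix (Fin (r + 1)) (Fin (r + 1)) R)
    (hA : ∀ i : Fin r, f (A i.succ 0) = 0) {j : Fin (r + 1)} (hj : j ≠ 0) :
    f (A.submatrix Fin.succ j.succAbove).det = 0 := by
  obtain ⟨k, hk⟩ := Fin.exists_succAbove_eq hj.symm
  rw [RingHom.map_det]
  refine Matrix.det_eq_zero_of_column_eq_zero k fun i => ?_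
  simpa [hk] using hA i


/-- **Nonvanishing of the residual quadric** (local matrix form of Lemma 2.9): if a
symmetric `(r+1) × (r+1)` matrix `q` over a local ring has its row `0` divisible by the
non-zerodivisor non-unit `t`, and the ideal generated by `det q` equals the ideal
generated by `t` (the discriminant scheme equals the divisor `{t = 0}`), then the
complementary `r × r` minor obtained by deleting row `0` and column `0` is a unit (the
rank of `q` on the divisor is `r`), and the residual quadratic form `(q 0 0) / t` is a
unit (it vanishes nowhere on the divisor). -/
theorem residual_quadric_nonvanishing {R : Type*} [CommRing R] [IsLocalRing R]
    (t : R) (ht : t ∈ nonZeroDivisors R) (htu : ¬ IsUnit t)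
    {r : ℕ} (q : Matrix (Fin (r + 1)) (Fin (r + 1)) R) (hq : q.IsSymm)
    (hdiv : ∀ j : Fin (r + 1), t ∣ q 0 j)
    (hdet : Ideal.span {q.det} = Ideal.span {t}) :
    IsUnit (q.submatrix Fin.succ Fin.succ).det ∧
    (∃ c : R, q 0 0 = t * c) ∧
    (∀ c : R, q 0 0 = t * c → IsUnit c) := by
  choose a ha using hdiv
  let f := IsLocalRing.residue R
  have hft : f t = 0 := (IsLocalRing.residue_eq_zero_iff t).2 htu
  let D := ∑ j : Fin (r + 1), (-1) ^ (j : ℕ) * a j * (q.submatrix Fin.succ j.succAbove).det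
  have hqD : q.det = t * D := by
    rw [Matrix.det_succ_row_zero, Finset.mul_sum]
    refine Finset.sum_congr rfl fun j _ => ?_
    rw [ha j]
    ring
  have hD : IsUnit D := by
    obtain ⟨e, he⟩ := Ideal.mem_span_singleton.1 (hdet ▸ Ideal.mem_span_singleton_self t)
    refine IsUnit.of_mul_eq_one e ((mul_cancel_left_mem_nonZeroDivisors ht).1 ?_)
    rw [← mul_assoc, ← hqD, ← he, mul_one]
  have hcol (i : Fin r) : f (q i.succ 0) = 0 := by
    rw [← hq.apply, ha, map_mul, hft, zero_mul]
  have hfD : f D = f (a 0 * (q.submatrix Fin.succ Fin.succ).det) := by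
    rw [map_sum, Finset.sum_eq_single 0]
    · simp
    · intro j _ hj
      rw [map_mul, map_det_submatrix_succAbove_eq_zero f q hcol hj, mul_zero]
    · simp
  have hu : IsUnit (a 0 * (q.submatrix Fin.succ Fin.succ).det) :=
    isUnit_of_map_unit f _ (hfD ▸ hD.map f)
  refine ⟨isUnit_of_mul_isUnit_right hu, ⟨a 0, ha 0⟩, fun c hc => ?_⟩
  rw [(mul_cancel_left_mem_nonZeroDivisors ht).1 (hc.symm.trans (ha 0))]
  exact isUnit_of_mul_isUnit_left hu
end

section
/- Let R be a commutative ring, let u ∈ R be a non-zerodivisor, let r be a natural number, and let q : Matrix (Fin (r+1)) (Fin (r+1)) R be a symmetric matrix (q.IsSymm) such that u^2 divides q 0 j for every j. Let D : Matrix (Fin (r+1)) (Fin (r+1)) R be the diagonal matrix with diagonal entries d 0 = u and d i = 1 for i ≠ 0. Then there exists a unique matrix q̃ : Matrix (Fin (r+1)) (Fin (r+1)) R with q = D * q̃ * D; moreover this q̃ is symmetric and u divides q̃ 0 j for every j ≠ 0. -/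
theorem Matrix.diagonal_mul_mul_diagonal_injective {n R : Type*} [Fintype n] [DecidableEq n]
    [CommRing R] {d : n → R} (hd : ∀ i, d i ∈ nonZeroDivisors R) :
    Function.Injective fun M : Matrix n n R => Matrix.diagonal d * M * Matrix.diagonal d := by
  intro M N h
  ext i j
  have hij := congrFun₂ h i j
  simp only [Matrix.mul_diagonal, Matrix.diagonal_mul] at hij
  exact (mul_cancel_left_mem_nonZeroDivisors (hd i)).1
    ((mul_cancel_right_mem_nonZeroDivisors (hd j)).1 hij)

/-- **Hecke transform of a family of quadratic forms** (local matrix form of Lemma 2.10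
and Proposition 2.11): if `q` is a symmetric `(r+1) × (r+1)` matrix whose row `0` is
divisible by `u ^ 2` for a non-zerodivisor `u`, and `D = diag(u, 1, …, 1)`, then there is
a unique matrix `q̃` with `q = D * q̃ * D`; moreover `q̃` is symmetric and `u` divides
`q̃ 0 j` for every `j ≠ 0` (orthogonality of the two summands of the canonical
splitting). -/
theorem hecke_transform {R : Type*} [CommRing R]
    (u : R) (hu : u ∈ nonZeroDivisors R)
    {r : ℕ} (q : Matrix (Fin (r + 1)) (Fin (r + 1)) R) (hq : q.IsSymm)
    (hdiv : ∀ j : Fin (r + 1), u ^ 2 ∣ q 0 j)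
    (D : Matrix (Fin (r + 1)) (Fin (r + 1)) R)
    (hD : D = Matrix.diagonal (fun i => if i = 0 then u else 1)) :
    ∃ qt : Matrix (Fin (r + 1)) (Fin (r + 1)) R,
      q = D * qt * D ∧
      (∀ qt' : Matrix (Fin (r + 1)) (Fin (r + 1)) R, q = D * qt' * D → qt' = qt) ∧
      qt.IsSymm ∧
      (∀ j : Fin (r + 1), j ≠ 0 → u ∣ qt 0 j) := by
  subst hD
  set d : Fin (r + 1) → R := fun i => if i = 0 then u else 1 with hd
  have hd_mem : ∀ i, d i ∈ nonZeroDivisors R := fun i => by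
    by_cases hi : i = 0 <;> simp [hd, hi, hu, one_mem]
  choose c hc using hdiv
  let qt : Matrix (Fin (r + 1)) (Fin (r + 1)) R := fun i j =>
    if i = 0 then (if j = 0 then c 0 else u * c j) else (if j = 0 then u * c i else q i j)
  have hqt : q = Matrix.diagonal d * qt * Matrix.diagonal d := by
    ext i j
    rw [Matrix.mul_diagonal, Matrix.diagonal_mul]
    by_cases hi : i = 0 <;> by_cases hj : j = 0
    · simp only [hi, hj, hc, hd, qt, if_true]
      ring
    · simp only [hi, hj, hc, hd, qt, if_true, if_false]
      ring
    · simp only [hi, hj, ← hq.apply i 0, hc, hd, qt, if_true, if_false]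
      ring
    · simp [hi, hj, hd, qt]
  have huniq : ∀ qt', q = Matrix.diagonal d * qt' * Matrix.diagonal d → qt' = qt :=
    fun qt' h => Matrix.diagonal_mul_mul_diagonal_injective hd_mem (h.symm.trans hqt)
  refine ⟨qt, hqt, huniq, huniq _ ?_, fun j hj => ?_⟩
  · rw [← hq.eq]
    nth_rewrite 1 [hqt]
    simp [Matrix.transpose_mul, Matrix.mul_assoc]
  · simp [qt, hj]
end
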